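/- arXiv:2509.06273 — 6 statements merged into one kernel-verified Lean document; each statement's English description precedes it below -/
import Mathlib

section
/- (Lemma 3.6, base case) Suppose every edge of G is incident to the last vertex v_n, so that X = [m], and suppose m is odd. Then for every d ∈ {0,1,…,n−1}, the bipartite graph H_X with the weight function M_{G,d}^occ satisfies the normalized matching property (NMP-B): there exists ω : F → ℝ≥0 such that for every vertex U of H_X, the sum of ω(e) over edges e of H_X incident to U equals M_{G,d}^occ(U). -/
open Finset
open scoped Classical

/- A finite graph `G` with vertices labeled `1,…,n` and edges `e_1,…,e_m` is
encoded by endpoint maps `ga gb : Fin m → ℕ` (with values in `[1,n]`), edge `j`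
joining vertices `ga j` and `gb j` (a loop when `ga j = gb j`).  The edge `e_t`
of the paper (`1 ≤ t ≤ m`) is the index `t - 1 : Fin m`, and the vertex `v_t`
is the label `t : ℕ`; in particular the last vertex `v_n` is the label `n`.
An orientation is `O : Fin m → Bool` (`true`: from `ga j` to `gb j`),
normalized to `false` on loops; a loop at `v` counts as one outgoing and one
incoming edge at `v`. -/

/-- Edges outgoing from vertex `v` under orientation `O`. -/
def outAt {m : ℕ} (ga gb : Fin m → ℕ) (O : Fin m → Bool) (v : ℕ) : Finset (Fin m) :=
  Finset.univ.filter fun j => (O j = true ∧ ga j = v) ∨ (O j = false ∧ gb j = v)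

/-- Edges incoming to vertex `v` under orientation `O`. -/
def inAt {m : ℕ} (ga gb : Fin m → ℕ) (O : Fin m → Bool) (v : ℕ) : Finset (Fin m) :=
  Finset.univ.filter fun j => (O j = true ∧ gb j = v) ∨ (O j = false ∧ ga j = v)

/-- The set of (indices of) edges incident to vertex `v`. -/
def edgesAt {m : ℕ} (ga gb : Fin m → ℕ) (v : ℕ) : Finset (Fin m) :=
  Finset.univ.filter fun j => ga j = v ∨ gb j = v

/-- The degree of vertex `v` (loops counted twice). -/
def degAt {m : ℕ} (ga gb : Fin m → ℕ) (v : ℕ) : ℕ :=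
  (Finset.univ.filter fun j => ga j = v).card + (Finset.univ.filter fun j => gb j = v).card

/-- `M_{G,d}^occ(S)`: the number of `d`-admissible orientations `O` of `G` with
`Out_O(v_n) = S` and `In_O(v_n) = X ∖ S`, where `X = edgesAt ga gb n`. -/
def MoccW (n : ℕ) {m : ℕ} (ga gb : Fin m → ℕ) (d : ℕ) (S : Finset (Fin m)) : ℕ :=
  (Finset.univ.filter fun O : Fin m → Bool =>
    (∀ j, ga j = gb j → O j = false) ∧
    (∀ i : ℕ, 1 ≤ i → i ≤ d → 1 ≤ (outAt ga gb O i).card ∧ 1 ≤ (inAt ga gb O i).card) ∧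
    outAt ga gb O n = S ∧ inAt ga gb O n = edgesAt ga gb n \ S).card

/-- The normalized matching property (NMP-B) for the bipartite graph `H_X`
(parts: `k`-subsets and `(k+1)`-subsets of `X`, edges: strict inclusions) with
vertex weight `g`: there is a nonnegative edge weight `ω` whose sums at each
vertex recover `g`. -/
def NMPB {m : ℕ} (X : Finset (Fin m)) (k : ℕ) (g : Finset (Fin m) → ℝ) : Prop :=
  ∃ ω : Finset (Fin m) → Finset (Fin m) → ℝ,
    (∀ S T, 0 ≤ ω S T) ∧
    (∀ S : Finset (Fin m), S ⊆ X → S.card = k →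
      (∑ T ∈ Finset.univ.filter
          (fun T : Finset (Fin m) => T ⊆ X ∧ T.card = k + 1 ∧ S ⊆ T), ω S T) = g S) ∧
    (∀ T : Finset (Fin m), T ⊆ X → T.card = k + 1 →
      (∑ S ∈ Finset.univ.filter
          (fun S : Finset (Fin m) => S ⊆ X ∧ S.card = k ∧ S ⊆ T), ω S T) = g T)

noncomputable def eS {m : ℕ} (S : Finset (Fin m)) : MvPolynomial (Fin m) ℝ :=
  ∏ x ∈ S, MvPolynomial.X x

lemma eS_mul {m : ℕ} {S T : Finset (Fin m)} (h : Disjoint S T) : eS S * eS T = eS (S ∪ T) := by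
  unfold eS; rw [Finset.prod_union h]

lemma eS_coeff {m : ℕ} (S T : Finset (Fin m)) :
    MvPolynomial.coeff (∑ x ∈ S, Finsupp.single x 1) (eS T) = if S = T then (1:ℝ) else 0 := by
  have h : eS T = MvPolynomial.monomial (∑ x ∈ T, Finsupp.single x 1) (1:ℝ) := by
    unfold eS
    rw [MvPolynomial.monomial_sum_one]
    rfl
  rw [h, MvPolynomial.coeff_monomial]
  have : ((∑ x ∈ T, Finsupp.single x 1 : Fin m →₀ ℕ) = ∑ x ∈ S, Finsupp.single x 1) ↔ S = T := by
    constructor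
    · intro h
      ext x
      have := DFunLike.congr_fun h x
      simp only [Finsupp.finsetSum_apply, Finsupp.single_apply, Finset.sum_ite_eq'] at this
      by_cases h1 : x ∈ S <;> by_cases h2 : x ∈ T <;> simp_all
    · rintro rfl; rfl
  simp only [this]

structure IsCh {m : ℕ} (X : Finset (Fin m)) (l p : ℕ) (c : ℕ → Finset (Fin m)) : Prop where
  sub : ∀ j < p, c j ⊆ X
  card : ∀ j < p, (c j).card = l + j
  mono : ∀ j, j + 1 < p → c j ⊆ c (j+1)

noncomputable def Dec {m : ℕ} (N : ℕ) (X : Finset (Fin m)) : AddSubmonoid (MvPolynomial (Fin m) ℝ) :=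
  AddSubmonoid.closure {f | ∃ l p c, 0 < p ∧ 2 * l + p = N + 1 ∧ IsCh X l p c ∧
    f = ∑ j ∈ range p, eS (c j)}

lemma chain_mem {m N l p : ℕ} {X : Finset (Fin m)} {c : ℕ → Finset (Fin m)}
    (h : IsCh X l p c) (hN : 2 * l + p = N + 1) : ∑ j ∈ range p, eS (c j) ∈ Dec N X := by
  rcases Nat.eq_zero_or_pos p with rfl | hp
  · simp
  · exact AddSubmonoid.subset_closure ⟨l, p, c, hp, hN, h, rfl⟩

lemma chain_mul {m : ℕ} {X Y : Finset (Fin m)} (hXY : Disjoint X Y) {a : ℕ → Finset (Fin m)}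
    {K : ℕ} (la p : ℕ) : ∀ (lb q : ℕ) (b : ℕ → Finset (Fin m)), IsCh X la p a → IsCh Y lb q b →
    2 * la + p + 2 * lb + q = K + 2 →
    (∑ j ∈ range p, eS (a j)) * (∑ j ∈ range q, eS (b j)) ∈ Dec K (X ∪ Y) := by
  induction p with
  | zero => intros; simp
  | succ p ih =>
    intro lb q b ha hb hK
    rcases q with _ | q
    · simp
    have dj : ∀ i < p + 1, ∀ j < q + 1, Disjoint (a i) (b j) := fun i hi j hj =>
      Disjoint.mono (ha.sub i hi) (hb.sub j hj) hXY
    have h1 := ih (lb + 1) q (fun j => b (j+1))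
      ⟨fun j hj => ha.sub j (by omega), fun j hj => ha.card j (by omega),
        fun j hj => ha.mono j (by omega)⟩
      ⟨fun j hj => hb.sub _ (by omega), fun j hj => by rw [hb.card _ (by omega)]; omega,
        fun j hj => hb.mono _ (by omega)⟩ (by omega)
    have hc : IsCh (X ∪ Y) (la + lb) (p + 1 + q)
        (fun j => if j ≤ p then a j ∪ b 0 else a p ∪ b (j - p)) := by
      refine ⟨fun j hj => ?_, fun j hj => ?_, fun j hj => ?_⟩
      · try dsimp only
        split_ifs with h
        · exact Finset.union_subset_union (ha.sub _ (by omega)) (hb.sub _ (by omega))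
        · exact Finset.union_subset_union (ha.sub _ (by omega)) (hb.sub _ (by omega))
      · try dsimp only
        split_ifs with h
        · rw [Finset.card_union_of_disjoint (dj _ (by omega) _ (by omega)),
            ha.card _ (by omega), hb.card _ (by omega)]; omega
        · rw [Finset.card_union_of_disjoint (dj _ (by omega) _ (by omega)),
            ha.card _ (by omega), hb.card _ (by omega)]; omega
      · try dsimp only
        split_ifs with h h' h'
        · exact Finset.union_subset_union (ha.mono _ (by omega)) subset_rfl
        · obtain rfl : j = p := by omega
          have : j + 1 - j = 0 + 1 := by omega
          rw [this]
          exact Finset.union_subset_union subset_rfl (hb.mono _ (by omega))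
        · omega
        · have : j + 1 - p = (j - p) + 1 := by omega
          rw [this]
          exact Finset.union_subset_union subset_rfl (hb.mono _ (by omega))
    have h2 := chain_mem (N := K) hc (by omega)
    have e2 : ∑ j ∈ range (p + 1 + q), eS (if j ≤ p then a j ∪ b 0 else a p ∪ b (j - p))
        = (∑ j ∈ range (p+1), eS (a j) * eS (b 0)) + ∑ j ∈ range q, eS (a p) * eS (b (j+1)) := by
      rw [Finset.sum_range_add]
      congr 1
      · refine Finset.sum_congr rfl fun j hj => ?_
        rw [Finset.mem_range] at hj
        rw [if_pos (by omega), eS_mul (dj _ (by omega) _ (by omega))]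
      · refine Finset.sum_congr rfl fun j hj => ?_
        rw [Finset.mem_range] at hj
        rw [if_neg (by omega), eS_mul (dj _ (by omega) _ (by omega))]
        congr 3; omega
    have := add_mem h2 h1
    rw [e2] at this
    convert this using 1
    rw [Finset.sum_range_succ' (fun j => eS (b j)), ← Finset.sum_mul, ← Finset.mul_sum,
      Finset.sum_range_succ (fun j => eS (a j))]
    ring

lemma Dec_mul {m : ℕ} {X Y : Finset (Fin m)} (hXY : Disjoint X Y) {N M : ℕ}
    {f g : MvPolynomial (Fin m) ℝ} (hf : f ∈ Dec N X) (hg : g ∈ Dec M Y) :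
    f * g ∈ Dec (N + M) (X ∪ Y) := by
  unfold Dec at hf hg
  induction hf using AddSubmonoid.closure_induction with
  | zero => simp
  | add x y _ _ hx hy => rw [add_mul]; exact add_mem hx hy
  | mem x hx =>
    obtain ⟨l, p, c, hp, hl, hc, rfl⟩ := hx
    induction hg using AddSubmonoid.closure_induction with
    | zero => simp
    | add x y _ _ hx hy => rw [mul_add]; exact add_mem hx hy
    | mem x hx =>
      obtain ⟨l', p', c', hp', hl', hc', rfl⟩ := hx
      exact chain_mul hXY _ _ _ _ _ hc hc' (by omega)

lemma Dec_sing {m : ℕ} (x : Fin m) : 1 + MvPolynomial.X x ∈ Dec 1 {x} := by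
  have : IsCh {x} 0 2 (fun j => if j = 0 then ∅ else {x}) := by
    refine ⟨fun j hj => ?_, fun j hj => ?_, fun j hj => ?_⟩
    · split_ifs <;> simp
    · split_ifs <;> simp <;> omega
    · split_ifs <;> first | omega | simp
  have := chain_mem (N := 1) this (by omega)
  simpa [Finset.sum_range_succ, eS] using this

lemma exists_full {m : ℕ} (X : Finset (Fin m)) : ∃ c, IsCh X 0 (X.card + 1) c ∧
    ∃ r ∈ Dec X.card X, ∏ x ∈ X, (1 + MvPolynomial.X x) =
      ∑ j ∈ range (X.card + 1), eS (c j) + r := by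
  induction X using Finset.induction_on with
  | empty =>
    refine ⟨fun _ => ∅, ⟨by simp, by simp, by simp⟩, 0, zero_mem _, by simp [eS]⟩
  | insert x X hx ih =>
    obtain ⟨c, hc, r, hr, he⟩ := ih
    rw [Finset.card_insert_of_notMem hx]
    have hd : Disjoint X {x} := by simpa using hx
    have hins : insert x X = X ∪ {x} := by ext; simp [or_comm]
    have nx : ∀ j < X.card + 1, Disjoint (c j) {x} := fun j hj => Disjoint.mono_left (hc.sub j hj) hd
    have hcX : c X.card = X := Finset.eq_of_subset_of_card_le (hc.sub _ (by omega))
      (by rw [hc.card _ (by omega)]; omega)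
    have h3 : IsCh (insert x X) 1 X.card (fun j => c j ∪ {x}) := by
      refine ⟨fun j hj => ?_, fun j hj => ?_, fun j hj => ?_⟩
      · rw [hins]; exact Finset.union_subset_union (hc.sub _ (by omega)) subset_rfl
      · rw [Finset.card_union_of_disjoint (nx _ (by omega)), hc.card _ (by omega)]; simp; omega
      · exact Finset.union_subset_union (hc.mono _ (by omega)) subset_rfl
    have h4 := Dec_mul hd hr (Dec_sing x)
    rw [← hins] at h4
    refine ⟨fun j => if j ≤ X.card then c j else X ∪ {x}, ?_, _,
      add_mem (chain_mem h3 (by omega)) h4, ?_⟩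
    · refine ⟨fun j hj => ?_, fun j hj => ?_, fun j hj => ?_⟩
      · try dsimp only
        split_ifs with h
        · exact (hc.sub _ (by omega)).trans (Finset.subset_insert _ _)
        · rw [hins]
      · try dsimp only
        split_ifs with h
        · exact hc.card _ (by omega)
        · rw [← hins, Finset.card_insert_of_notMem hx]; omega
      · try dsimp only
        split_ifs with h h' h'
        · exact hc.mono _ (by omega)
        · exact (hc.sub _ (by omega)).trans Finset.subset_union_left
        · omega
        · exact subset_rfl
    · beta_reduce
      rw [Finset.prod_insert hx, he, Finset.sum_range_succ _ (X.card + 1), if_neg (by omega)]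
      have e1 : ∑ j ∈ range (X.card + 1), eS (if j ≤ X.card then c j else X ∪ {x})
          = ∑ j ∈ range (X.card + 1), eS (c j) := by
        refine Finset.sum_congr rfl fun j hj => ?_
        rw [Finset.mem_range] at hj
        rw [if_pos (by omega)]
      have ex : eS {x} = (MvPolynomial.X x : MvPolynomial (Fin m) ℝ) := by simp [eS]
      have e2 : ∑ j ∈ range X.card, eS (c j ∪ {x})
          = (∑ j ∈ range X.card, eS (c j)) * MvPolynomial.X x := by
        rw [Finset.sum_mul]
        refine Finset.sum_congr rfl fun j hj => ?_
        rw [Finset.mem_range] at hj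
        rw [← eS_mul (nx _ (by omega)), ex]
      rw [e1, e2, ← eS_mul hd, ex, Finset.sum_range_succ, hcX]
      ring

def Good {m : ℕ} (X : Finset (Fin m)) (p : Finset (Fin m) → Prop) : Prop :=
  ∑ S ∈ X.powerset, (if p S then eS S else 0) ∈ Dec X.card X

lemma prod_eq {m : ℕ} (X : Finset (Fin m)) :
    ∏ x ∈ X, (1 + MvPolynomial.X x) = ∑ S ∈ X.powerset, eS S := by
  rw [Finset.prod_one_add]; rfl

lemma good_true {m : ℕ} (X : Finset (Fin m)) : Good X (fun _ => True) := by
  obtain ⟨c, hc, r, hr, he⟩ := exists_full X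
  unfold Good
  simp only [if_true]
  rw [← prod_eq, he]
  exact add_mem (chain_mem hc (by omega)) hr

lemma good_trunc {m : ℕ} (X : Finset (Fin m)) : Good X (fun S => S ≠ ∅ ∧ S ≠ X) := by
  unfold Good
  rcases Nat.lt_or_ge X.card 2 with h | h
  · rw [Finset.sum_eq_zero]
    · exact zero_mem _
    · intro S hS
      rw [Finset.mem_powerset] at hS
      rw [if_neg]
      rintro ⟨h1, h2⟩
      have := Finset.card_lt_card (Finset.ssubset_iff_subset_ne.2 ⟨hS, h2⟩)
      have := Finset.card_pos.2 (Finset.nonempty_iff_ne_empty.2 h1)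
      omega
  obtain ⟨c, hc, r, hr, he⟩ := exists_full X
  have hcX : c X.card = X := Finset.eq_of_subset_of_card_le (hc.sub _ (by omega))
      (by rw [hc.card _ (by omega)]; omega)
  have hc0 : c 0 = ∅ := Finset.card_eq_zero.1 (hc.card 0 (by omega))
  have hX : X ≠ ∅ := by rintro rfl; simp at h
  have e1 : ∑ S ∈ X.powerset, eS S = ∑ S ∈ X.powerset, (if S ≠ ∅ ∧ S ≠ X then eS S else 0)
      + eS ∅ + eS X := by
    have a1 : eS (∅ : Finset (Fin m)) = ∑ S ∈ X.powerset, if S = ∅ then eS S else 0 := by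
      rw [Finset.sum_ite_eq']; simp
    have a2 : eS X = ∑ S ∈ X.powerset, if S = X then eS S else 0 := by
      rw [Finset.sum_ite_eq']; simp
    rw [a1, a2, ← Finset.sum_add_distrib, ← Finset.sum_add_distrib]
    refine Finset.sum_congr rfl fun S _ => ?_
    by_cases h1 : S = ∅
    · subst h1; simp [hX.symm]
    · by_cases h2 : S = X <;> simp [h1, h2]
      simp [hX]
  obtain ⟨t, ht⟩ : ∃ t, X.card = t + 1 := ⟨X.card - 1, by omega⟩
  have h5 : IsCh X 1 t (fun j => c (j+1)) :=
    ⟨fun j hj => hc.sub _ (by omega), fun j hj => by rw [hc.card _ (by omega)]; omega,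
      fun j hj => hc.mono _ (by omega)⟩
  have := add_mem (chain_mem (N := X.card) h5 (by omega)) hr
  convert this using 1
  rw [prod_eq, e1, Finset.sum_range_succ, hcX, ht, Finset.sum_range_succ', hc0] at he
  have he' : ∑ S ∈ X.powerset, (if S ≠ ∅ ∧ S ≠ X then eS S else 0) =
      ∑ j ∈ range t, eS (c (j + 1)) + r := by linear_combination he
  refine Eq.trans (Finset.sum_congr rfl fun S _ => ?_) he'
  congr

lemma good_mul {m : ℕ} {X Y : Finset (Fin m)} (hXY : Disjoint X Y) {p q : Finset (Fin m) → Prop}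
    (hp : Good X p) (hq : Good Y q) : Good (X ∪ Y) (fun U => p (U ∩ X) ∧ q (U ∩ Y)) := by
  have := Dec_mul hXY hp hq
  unfold Good
  rw [Finset.card_union_of_disjoint hXY]
  convert this using 1
  rw [Finset.sum_mul_sum, ← Finset.sum_product']
  symm
  refine Finset.sum_bij' (fun x _ => x.1 ∪ x.2) (fun U _ => (U ∩ X, U ∩ Y)) ?_ ?_ ?_ ?_ ?_
  · rintro ⟨S, T⟩ h
    simp only [Finset.mem_product, Finset.mem_powerset] at h ⊢
    exact Finset.union_subset_union h.1 h.2
  · intro U h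
    simp
  · rintro ⟨S, T⟩ h
    simp only [Finset.mem_product, Finset.mem_powerset] at h
    rw [Finset.disjoint_left] at hXY
    ext x <;> simp <;> grind
  · intro U h
    simp only [Finset.mem_powerset] at h
    ext x; simp; grind
  · rintro ⟨S, T⟩ h
    simp only [Finset.mem_product, Finset.mem_powerset] at h
    have h1 : (S ∪ T) ∩ X = S := by
      rw [Finset.disjoint_left] at hXY
      ext x; simp; grind
    have h2 : (S ∪ T) ∩ Y = T := by
      rw [Finset.disjoint_left] at hXY
      ext x; simp; grind
    simp only [h1, h2]
    rw [← eS_mul (Disjoint.mono h.1 h.2 hXY)]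
    by_cases hp : p S <;> by_cases hq : q T <;> simp [hp, hq]

lemma good_congr {m : ℕ} {X : Finset (Fin m)} {p q : Finset (Fin m) → Prop}
    (hp : Good X p) (h : ∀ S ⊆ X, p S ↔ q S) : Good X q := by
  unfold Good at *
  convert hp using 1
  refine Finset.sum_congr rfl fun S hS => ?_
  try simp only [h S (Finset.mem_powerset.1 hS)]

lemma good_blocks {m : ℕ} (E : ℕ → Finset (Fin m)) (d : ℕ)
    (hE : ∀ i ≤ d, ∀ j ≤ d, i ≠ j → Disjoint (E i) (E j)) :
    ∃ X, (∀ x ∈ X, ∃ i, 1 ≤ i ∧ i ≤ d ∧ x ∈ E i) ∧ (∀ i, 1 ≤ i → i ≤ d → E i ⊆ X) ∧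
    Good X (fun S => ∀ i, 1 ≤ i → i ≤ d → (∃ x ∈ E i, x ∈ S) ∧ (∃ x ∈ E i, x ∉ S)) := by
  induction d with
  | zero =>
    refine ⟨∅, by simp, fun i h1 h2 => by omega, good_congr (good_true _) fun S _ => ?_⟩
    simp only [true_iff]
    intro i h1 h2; omega
  | succ d ih =>
    obtain ⟨X, h1, h2, h3⟩ := ih fun i hi j hj => hE i (by omega) j (by omega)
    have hd : Disjoint X (E (d+1)) := by
      rw [Finset.disjoint_left]
      intro x hx
      obtain ⟨i, hi, hi', hxi⟩ := h1 x hx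
      exact Finset.disjoint_left.1 (hE i (by omega) (d+1) le_rfl (by omega)) hxi
    refine ⟨X ∪ E (d+1), ?_, ?_, good_congr (good_mul hd h3 (good_trunc _)) ?_⟩
    · intro x hx
      rcases Finset.mem_union.1 hx with hx | hx
      · obtain ⟨i, hi, hi', hxi⟩ := h1 x hx
        exact ⟨i, hi, by omega, hxi⟩
      · exact ⟨d+1, by omega, le_rfl, hx⟩
    · intro i hi hi'
      rcases Nat.lt_or_ge i (d+1) with h | h
      · exact (h2 i hi (by omega)).trans Finset.subset_union_left
      · obtain rfl : i = d + 1 := by omega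
        exact Finset.subset_union_right
    · intro S hS
      have a1 : (S ∩ E (d+1) ≠ ∅ ∧ S ∩ E (d+1) ≠ E (d+1)) ↔
          (∃ x ∈ E (d+1), x ∈ S) ∧ (∃ x ∈ E (d+1), x ∉ S) := by
        rw [← Finset.nonempty_iff_ne_empty, Ne, Finset.inter_eq_right, Finset.not_subset]
        simp [Finset.Nonempty, and_comm]
      rw [a1]
      have a2 : ∀ i, 1 ≤ i → i ≤ d → (((∃ x ∈ E i, x ∈ S ∩ X) ∧ (∃ x ∈ E i, x ∉ S ∩ X)) ↔
          ((∃ x ∈ E i, x ∈ S) ∧ (∃ x ∈ E i, x ∉ S))) := by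
        intro i hi hi'
        have := h2 i hi hi'
        have hh : ∀ x ∈ E i, (x ∈ S ∩ X ↔ x ∈ S) := fun x hx => by simp [this hx]
        constructor
        · rintro ⟨⟨x, hx, hx'⟩, ⟨y, hy, hy'⟩⟩
          exact ⟨⟨x, hx, (hh x hx).1 hx'⟩, ⟨y, hy, fun h => hy' ((hh y hy).2 h)⟩⟩
        · rintro ⟨⟨x, hx, hx'⟩, ⟨y, hy, hy'⟩⟩
          exact ⟨⟨x, hx, (hh x hx).2 hx'⟩, ⟨y, hy, fun h => hy' ((hh y hy).1 h)⟩⟩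
      constructor
      · rintro ⟨b1, b2⟩ i hi hi'
        rcases Nat.lt_or_ge i (d+1) with h | h
        · exact (a2 i hi (by omega)).1 (b1 i hi (by omega))
        · obtain rfl : i = d + 1 := by omega
          exact b2
      · intro b
        exact ⟨fun i hi hi' => (a2 i hi hi').2 (b i hi (by omega)), b (d+1) (by omega) le_rfl⟩

lemma nmpb_dec {m k N : ℕ} (hN : N = 2 * k + 1) {f : MvPolynomial (Fin m) ℝ}
    (hf : f ∈ Dec N Finset.univ) :
    NMPB Finset.univ k
      (fun S => MvPolynomial.coeff (∑ x ∈ S, Finsupp.single x 1) f) := by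
  unfold Dec at hf
  induction hf using AddSubmonoid.closure_induction with
  | zero => exact ⟨fun _ _ => 0, by simp, by simp, by simp⟩
  | add x y _ _ hx hy =>
    obtain ⟨w, h1, h2, h3⟩ := hx
    obtain ⟨w', h1', h2', h3'⟩ := hy
    refine ⟨fun S T => w S T + w' S T, fun S T => add_nonneg (h1 _ _) (h1' _ _), ?_, ?_⟩
    · intro S hS hc
      rw [Finset.sum_add_distrib, h2 S hS hc, h2' S hS hc]; beta_reduce; rw [MvPolynomial.coeff_add]
    · intro S hS hc
      rw [Finset.sum_add_distrib, h3 S hS hc, h3' S hS hc]; beta_reduce; rw [MvPolynomial.coeff_add]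
  | mem x hx =>
    obtain ⟨l, p, c, hp, hl, hc, rfl⟩ := hx
    have key : ∀ t, l ≤ t → t < l + p → ∀ S : Finset (Fin m), S.card = t →
        MvPolynomial.coeff (∑ x ∈ S, Finsupp.single x 1) (∑ j ∈ range p, eS (c j))
        = if S = c (t - l) then 1 else 0 := by
      intro t h1 h2 S hS
      rw [MvPolynomial.coeff_sum]
      simp only [eS_coeff]
      rw [Finset.sum_eq_single (t - l)]
      · intro j hj hne
        rw [if_neg]
        rintro rfl
        rw [hc.card j (by simpa using hj)] at hS
        omega
      · intro h; simp at h; omega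
    have cs : c (k - l) ⊆ c (k + 1 - l) := by
      have := hc.mono (k - l) (by omega)
      rwa [show k - l + 1 = k + 1 - l by omega] at this
    have c1 : (c (k - l)).card = k := by rw [hc.card _ (by omega)]; omega
    have c2 : (c (k + 1 - l)).card = k + 1 := by rw [hc.card _ (by omega)]; omega
    refine ⟨fun S T => if S = c (k - l) ∧ T = c (k + 1 - l) then 1 else 0, ?_, ?_, ?_⟩
    · intro S T; beta_reduce; split_ifs <;> norm_num
    · intro S _ hS
      beta_reduce
      rw [key k (by omega) (by omega) S hS]
      by_cases h : S = c (k - l)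
      · subst h; simp [c2, cs, Finset.sum_ite_eq']
      · simp [h]
    · intro S _ hS
      beta_reduce
      rw [key (k+1) (by omega) (by omega) S hS]
      by_cases h : S = c (k + 1 - l)
      · subst h; simp [c1, cs, Finset.sum_ite_eq']
      · simp [h]

lemma mocc_eq (n : ℕ) (m : ℕ) (ga gb : Fin m → ℕ)
    (hall : ∀ j, ga j = n ∨ gb j = n) (hl : ∀ j, ga j ≠ gb j)
    (d : ℕ) (hd : d < n) (S : Finset (Fin m)) :
    MoccW n ga gb d S = if (∀ i, 1 ≤ i → i ≤ d → (∃ x ∈ edgesAt ga gb i, x ∈ S) ∧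
      (∃ x ∈ edgesAt ga gb i, x ∉ S)) then 1 else 0 := by
  have hO : ∀ O : Fin m → Bool, outAt ga gb O n = S ↔ O = fun j => decide (ga j = n ↔ j ∈ S) := by
    intro O
    rw [funext_iff, Finset.ext_iff]
    refine forall_congr' fun j => ?_
    simp only [outAt, Finset.mem_filter, Finset.mem_univ, true_and]
    have := hall j; have := hl j
    by_cases h1 : ga j = n <;> by_cases h2 : j ∈ S <;> cases hh : O j <;> simp [h1, h2] <;> grind
  have hI : inAt ga gb (fun j => decide (ga j = n ↔ j ∈ S)) n = edgesAt ga gb n \ S := by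
    ext j
    simp only [inAt, edgesAt, Finset.mem_filter, Finset.mem_univ, true_and, Finset.mem_sdiff]
    have := hall j; have := hl j
    by_cases h1 : ga j = n <;> by_cases h2 : j ∈ S <;> simp [h1, h2] <;> grind
  have ho : ∀ i ≤ d, (1 ≤ (outAt ga gb (fun j => decide (ga j = n ↔ j ∈ S)) i).card ↔
      ∃ x ∈ edgesAt ga gb i, x ∉ S) := by
    intro i hi
    rw [Nat.one_le_iff_ne_zero, ← Nat.pos_iff_ne_zero, Finset.card_pos]
    refine exists_congr fun j => ?_
    simp only [outAt, edgesAt, Finset.mem_filter, Finset.mem_univ, true_and]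
    have := hall j; have := hl j
    by_cases h1 : ga j = n <;> by_cases h2 : j ∈ S <;> simp [h1, h2] <;> grind
  have hi : ∀ i ≤ d, (1 ≤ (inAt ga gb (fun j => decide (ga j = n ↔ j ∈ S)) i).card ↔
      ∃ x ∈ edgesAt ga gb i, x ∈ S) := by
    intro i hi
    rw [Nat.one_le_iff_ne_zero, ← Nat.pos_iff_ne_zero, Finset.card_pos]
    refine exists_congr fun j => ?_
    simp only [inAt, edgesAt, Finset.mem_filter, Finset.mem_univ, true_and]
    have := hall j; have := hl j
    by_cases h1 : ga j = n <;> by_cases h2 : j ∈ S <;> simp [h1, h2] <;> grind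
  unfold MoccW
  split_ifs with hp
  · rw [Finset.card_eq_one]
    refine ⟨fun j => decide (ga j = n ↔ j ∈ S), ?_⟩
    ext O
    simp only [Finset.mem_filter, Finset.mem_univ, true_and, Finset.mem_singleton]
    constructor
    · rintro ⟨_, _, h, _⟩; exact (hO O).1 h
    · rintro rfl
      exact ⟨fun j hj => absurd hj (hl j), fun i h1 h2 =>
        ⟨(ho i h2).2 (hp i h1 h2).2, (hi i h2).2 (hp i h1 h2).1⟩, (hO _).2 rfl, hI⟩
  · rw [Finset.card_eq_zero, Finset.filter_eq_empty_iff]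
    rintro O - ⟨_, h, h', _⟩
    rw [hO] at h'
    subst h'
    exact hp fun i h1 h2 => ⟨(hi i h2).1 (h i h1 h2).2, (ho i h2).1 (h i h1 h2).1⟩

theorem lem_3_6 (n : ℕ) (hn : 1 ≤ n) (m : ℕ) (ga gb : Fin m → ℕ)
    (hga : ∀ j, 1 ≤ ga j ∧ ga j ≤ n) (hgb : ∀ j, 1 ≤ gb j ∧ gb j ≤ n)
    (hall : ∀ j, ga j = n ∨ gb j = n)
    (k : ℕ) (hm : m = 2 * k + 1)
    (d : ℕ) (hd : d ≤ n - 1) :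
    NMPB (edgesAt ga gb n) k (fun S => (MoccW n ga gb d S : ℝ)) := by
  by_cases hl : ∀ j, ga j ≠ gb j
  · have hX : edgesAt ga gb n = Finset.univ := by
      ext j; simp [edgesAt, hall j]
    rw [hX]
    obtain ⟨X, -, h2, h3⟩ := good_blocks (edgesAt ga gb) d (by
      intro i hi j hj hij
      rw [Finset.disjoint_left]
      intro x
      simp only [edgesAt, Finset.mem_filter, Finset.mem_univ, true_and]
      have := hall x
      omega)
    have h4 := good_mul (disjoint_compl_right (a := X)) h3 (good_true (Xᶜ))
    rw [Finset.union_compl] at h4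
    have h5 : Good Finset.univ (fun S => ∀ i, 1 ≤ i → i ≤ d →
        (∃ x ∈ edgesAt ga gb i, x ∈ S) ∧ (∃ x ∈ edgesAt ga gb i, x ∉ S)) := by
      refine good_congr h4 fun S _ => ?_
      simp only [and_true]
      refine forall_congr' fun i => forall_congr' fun h1 => forall_congr' fun h1' => ?_
      have := h2 i h1 h1'
      refine and_congr (exists_congr fun x => and_congr_right fun hx => ?_)
        (exists_congr fun x => and_congr_right fun hx => ?_) <;> simp [this hx]
    unfold Good at h5
    rw [Finset.card_univ, Fintype.card_fin] at h5
    have h6 := nmpb_dec hm h5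
    convert h6 using 2 with S
    rw [mocc_eq n m ga gb hall hl d (by omega), MvPolynomial.coeff_sum]
    rw [Finset.sum_eq_single S]
    · split_ifs <;> simp [eS_coeff]
    · intro T _ hT
      split_ifs
      · rw [eS_coeff, if_neg hT.symm]
      · simp
    · intro h; simp at h
  · push Not at hl
    obtain ⟨j, hj⟩ := hl
    have : ∀ S, MoccW n ga gb d S = 0 := by
      intro S
      unfold MoccW
      rw [Finset.card_eq_zero, Finset.filter_eq_empty_iff]
      rintro O - ⟨_, _, h1, h2⟩
      have hb : gb j = n := by have := hall j; omega
      have a1 : j ∈ outAt ga gb O n := by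
        simp only [outAt, Finset.mem_filter, Finset.mem_univ, true_and]
        cases O j <;> simp [hj, hb]
      have a2 : j ∈ inAt ga gb O n := by
        simp only [inAt, Finset.mem_filter, Finset.mem_univ, true_and]
        cases O j <;> simp [hj, hb]
      rw [h1] at a1
      rw [h2] at a2
      exact (Finset.mem_sdiff.1 a2).2 a1
    exact ⟨fun _ _ => 0, by simp, by simp [this], by simp [this]⟩
end

section
/- (Lemma 4.1) Let G be a finite graph (parallel edges and loops allowed) with ordered vertices v_1,…,v_n and ordered edges e_1,…,e_m, let X = {j ∈ [m] : e_j is incident to v_n} have odd cardinality, let d ∈ {0,1,…,n−1}, and let a = (a_1,…,a_d) ∈ ℕ^d. Then the bipartite graph H_X with the weight function M_{G,a} satisfies the normalized matching property (NMP-B): there exists ω : F → ℝ≥0 such that for every vertex U of H_X, the sum of ω(e) over edges e of H_X incident to U equals M_{G,a}(U). -/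
open Finset
open scoped Classical

/-- `M_{G,a}(S)`: the number of `a`-admissible orientations `O` of `G` with
`Out_O(v_n) = S` and `In_O(v_n) = X ∖ S`, where `X = edgesAt ga gb n`.
The vector `a = (a_1,…,a_d)` is encoded as `a : ℕ → ℕ` (only the values
`a 1, …, a d` are used). -/
def MballW (n : ℕ) {m : ℕ} (ga gb : Fin m → ℕ) (d : ℕ) (a : ℕ → ℕ) (S : Finset (Fin m)) : ℕ :=
  (Finset.univ.filter fun O : Fin m → Bool =>
    (∀ j, ga j = gb j → O j = false) ∧
    (∀ i : ℕ, 1 ≤ i → i ≤ d → (outAt ga gb O i).card = a i ∧ (inAt ga gb O i).card = a i) ∧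
    outAt ga gb O n = S ∧ inAt ga gb O n = edgesAt ga gb n \ S).card

lemma NMPB_sum {m : ℕ} {X : Finset (Fin m)} {k : ℕ} {β : Type*} (s : Finset β)
    (c : β → ℝ) (g : β → Finset (Fin m) → ℝ) (hc : ∀ i ∈ s, 0 ≤ c i)
    (h : ∀ i ∈ s, NMPB X k (g i)) : NMPB X k (fun S => ∑ i ∈ s, c i * g i S) := by
  have h' : ∀ i, ∃ ω : Finset (Fin m) → Finset (Fin m) → ℝ, i ∈ s →
    (∀ S T, 0 ≤ ω S T) ∧
    (∀ S : Finset (Fin m), S ⊆ X → S.card = k →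
      (∑ T ∈ Finset.univ.filter
          (fun T : Finset (Fin m) => T ⊆ X ∧ T.card = k + 1 ∧ S ⊆ T), ω S T) = g i S) ∧
    (∀ T : Finset (Fin m), T ⊆ X → T.card = k + 1 →
      (∑ S ∈ Finset.univ.filter
          (fun S : Finset (Fin m) => S ⊆ X ∧ S.card = k ∧ S ⊆ T), ω S T) = g i T) := by
    intro i
    by_cases hi : i ∈ s
    · obtain ⟨ω, hω⟩ := h i hi
      exact ⟨ω, fun _ => hω⟩
    · exact ⟨fun _ _ => 0, fun hh => absurd hh hi⟩
  choose ω hω using h'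
  refine ⟨fun S T => ∑ i ∈ s, c i * ω i S T, ?_, ?_, ?_⟩
  · intro S T
    exact Finset.sum_nonneg fun i hi => mul_nonneg (hc i hi) ((hω i hi).1 S T)
  · intro S hS hk
    rw [Finset.sum_comm]
    refine Finset.sum_congr rfl fun i hi => ?_
    rw [← Finset.mul_sum, (hω i hi).2.1 S hS hk]
  · intro S hS hk
    rw [Finset.sum_comm]
    refine Finset.sum_congr rfl fun i hi => ?_
    rw [← Finset.mul_sum, (hω i hi).2.2 S hS hk]

lemma NMPB_smul {m : ℕ} {X : Finset (Fin m)} {k : ℕ}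
    (c : ℝ) (g : Finset (Fin m) → ℝ) (hc : 0 ≤ c)
    (h : NMPB X k g) : NMPB X k (fun S => c * g S) := by
  have := NMPB_sum (X := X) (k := k) (Finset.univ : Finset Unit) (fun _ => c) (fun _ => g)
    (fun _ _ => hc) (fun _ _ => h)
  simpa using this

lemma NMPB_zero {m : ℕ} {X : Finset (Fin m)} {k : ℕ} : NMPB X k (fun _ => 0) :=
  ⟨fun _ _ => 0, by simp, by simp, by simp⟩

section core
variable {H : Type} [Fintype H] [DecidableEq H] {m : ℕ}

def Bal (v : H → ℕ) (A : Finset H) (f : H → Bool) : Prop :=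
  ∀ i, (A.filter fun h => v h = i ∧ f h = true).card = (A.filter fun h => v h = i ∧ f h = false).card

def outS (X : Finset (Fin m)) (ι : Fin m → H) (f : H → Bool) : Finset (Fin m) :=
  X.filter fun x => f (ι x) = true

noncomputable def GC (v : H → ℕ) (X : Finset (Fin m)) (ι : Fin m → H) (ε : H → H) (A : Finset H)
    (S : Finset (Fin m)) : ℕ :=
  (Finset.univ.filter fun f : H → Bool =>
    (∀ h, f (ε h) = !f h) ∧ Bal v A f ∧ outS X ι f = S).card

def flipOn (D : Finset H) (f : H → Bool) : H → Bool := fun h => if h ∈ D then !f h else f h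

lemma flipOn_flipOn (D : Finset H) (f : H → Bool) : flipOn D (flipOn D f) = f := by
  funext h; unfold flipOn; split_ifs <;> simp

lemma flipOn_valid (D : Finset H) (ε : H → H) (hD : ∀ h, ε h ∈ D ↔ h ∈ D) (f : H → Bool)
    (hf : ∀ h, f (ε h) = !f h) : ∀ h, flipOn D f (ε h) = !flipOn D f h := by
  intro h; unfold flipOn; simp only [hD, hf]; split_ifs <;> simp

lemma Bal_congr (v : H → ℕ) (A : Finset H) (f g : H → Bool) (h : ∀ x ∈ A, f x = g x) 
    (hf : Bal v A f) : Bal v A g := by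
  intro i
  have e1 : ∀ b : Bool, A.filter (fun h => v h = i ∧ g h = b) = A.filter (fun h => v h = i ∧ f h = b) :=
    fun b => Finset.filter_congr (by intro x hx; rw [h x hx])
  rw [e1, e1]
  exact hf i

lemma flip_base_le (v : H → ℕ) (X : Finset (Fin m)) (ι : Fin m → H) (hι : Function.Injective ι)
    (ε : H → H) (hε : ∀ h, ε (ε h) = h) (x : Fin m) (hx : x ∈ X)
    (hxe : ∀ y ∈ X, ε (ι x) ≠ ι y) (S T : Finset (Fin m))
    (hST : ∀ y, y ∈ T ↔ ((y ∈ S ∧ y ≠ x) ∨ (y = x ∧ x ∉ S))) :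
    GC v X ι ε ∅ S ≤ GC v X ι ε ∅ T := by
  unfold GC
  refine Finset.card_le_card_of_injOn (flipOn {ι x, ε (ι x)}) ?_ ?_
  · intro f hf
    simp only [Finset.coe_filter, Finset.mem_univ, true_and, Set.mem_ofPred_eq] at hf ⊢
    obtain ⟨h1, -, h3⟩ := hf
    refine ⟨flipOn_valid _ _ ?_ _ h1, ?_, ?_⟩
    · intro h
      simp only [Finset.mem_insert, Finset.mem_singleton]
      constructor
      · rintro (q | q)
        · right; rw [← q, hε]
        · left; rw [← hε h, q, hε]
      · rintro (h | h)
        · right; rw [h]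
        · left; rw [h, hε]
    · intro i; simp
    · ext y
      rw [hST, ← h3]
      simp only [outS, Finset.mem_filter, flipOn, Finset.mem_insert, Finset.mem_singleton]
      by_cases hy : y ∈ X
      · have := hxe y hy
        by_cases hyx : y = x
        · subst hyx; simp [hx]
        · have h2 : ι y ≠ ι x := fun h => hyx (hι h)
          simp [hy, h2, this.symm, hyx]
      · have : y ≠ x := fun h => hy (h ▸ hx)
        simp [hy, this]
  · intro f _ g _ h
    rw [← flipOn_flipOn {ι x, ε (ι x)} f, h, flipOn_flipOn]

lemma flip_base (v : H → ℕ) (X : Finset (Fin m)) (ι : Fin m → H) (hι : Function.Injective ι)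
    (ε : H → H) (hε : ∀ h, ε (ε h) = h) (x : Fin m) (hx : x ∈ X)
    (hxe : ∀ y ∈ X, ε (ι x) ≠ ι y) (S : Finset (Fin m)) (hS : x ∉ S) :
    GC v X ι ε ∅ (insert x S) = GC v X ι ε ∅ S := by
  apply le_antisymm
  · apply flip_base_le v X ι hι ε hε x hx hxe
    intro y
    simp only [Finset.mem_insert]
    grind
  · apply flip_base_le v X ι hι ε hε x hx hxe
    intro y
    simp only [Finset.mem_insert]
    grind

/-- internal elements are split evenly -/
lemma internal_card (X : Finset (Fin m)) (ι : Fin m → H) (hι : Function.Injective ι)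
    (ε : H → H) (hε : ∀ h, ε (ε h) = h) (f : H → Bool) (hf : ∀ h, f (ε h) = !f h) :
    (X.filter fun x => (∃ y ∈ X, ε (ι x) = ι y) ∧ f (ι x) = true).card =
    (X.filter fun x => (∃ y ∈ X, ε (ι x) = ι y) ∧ f (ι x) = false).card := by
  have key : ∀ b c : Bool, (c = !b) → 
    (X.filter fun x => (∃ y ∈ X, ε (ι x) = ι y) ∧ f (ι x) = b).card ≤
    (X.filter fun x => (∃ y ∈ X, ε (ι x) = ι y) ∧ f (ι x) = c).card := by
    intro b c hbc
    rw [← Finset.card_image_of_injective _ hι,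
      ← Finset.card_image_of_injective (X.filter fun x => (∃ y ∈ X, ε (ι x) = ι y) ∧ f (ι x) = c) hι]
    refine Finset.card_le_card_of_injOn ε ?_ ?_
    · intro h hh
      simp only [Finset.coe_image, Finset.coe_filter, Set.mem_image, Set.mem_ofPred_eq] at hh ⊢
      obtain ⟨x, ⟨hx, ⟨y, hy, hxy⟩, hb⟩, rfl⟩ := hh
      refine ⟨y, ⟨hy, ⟨x, hx, ?_⟩, ?_⟩, hxy.symm⟩
      · rw [← hxy, hε]
      · rw [← hxy, hf, hb, hbc]
    · intro a _ b _ h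
      rw [← hε a, h, hε]
  exact le_antisymm (key _ _ rfl) (key _ _ rfl)

lemma core_base (v : H → ℕ) (X : Finset (Fin m)) (k : ℕ) (hX : X.card = 2 * k + 1)
    (ι : Fin m → H) (hι : Function.Injective ι)
    (ε : H → H) (hε : ∀ h, ε (ε h) = h) :
    NMPB X k (fun S => (GC v X ι ε ∅ S : ℝ)) := by
  set Xi := X.filter fun x => (∃ y ∈ X, ε (ι x) = ι y) with hXi
  set Re := X.filter fun x => ¬ (∃ y ∈ X, ε (ι x) = ι y) with hRe
  have hcard : Xi.card + Re.card = 2 * k + 1 := by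
    rw [← hX, hXi, hRe, Finset.card_filter_add_card_filter_not]
  set p : ℝ := k + 1 - (Xi.card : ℝ) / 2 with hp
  have hp0 : 0 < p := by
    have : Xi.card ≤ 2 * k + 1 := by omega
    have : (Xi.card : ℝ) ≤ 2 * k + 1 := by exact_mod_cast this
    rw [hp]; linarith
  have hRX : ∀ x ∈ Re, x ∈ X := fun x hx => (Finset.mem_filter.1 hx).1
  have hRE : ∀ x ∈ Re, ∀ y ∈ X, ε (ι x) ≠ ι y := by
    intro x hx y hy h
    exact (Finset.mem_filter.1 hx).2 ⟨y, hy, h⟩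
  -- splitting of any set with nonzero weight
  have hsplit : ∀ S, S ⊆ X → GC v X ι ε ∅ S ≠ 0 →
      2 * (S ∩ Xi).card = Xi.card := by
    intro S hS h0
    obtain ⟨f, hf⟩ := Finset.card_pos.1 (Nat.pos_of_ne_zero h0)
    simp only [Finset.mem_filter, Finset.mem_univ, true_and] at hf
    obtain ⟨h1, -, h3⟩ := hf
    have h4 := internal_card X ι hι ε hε f h1
    have e1 : S ∩ Xi = X.filter fun x => (∃ y ∈ X, ε (ι x) = ι y) ∧ f (ι x) = true := by
      rw [← h3]; ext y
      simp only [outS, hXi, Finset.mem_inter, Finset.mem_filter]; tauto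
    have e2 : Xi.card = (X.filter fun x => (∃ y ∈ X, ε (ι x) = ι y) ∧ f (ι x) = true).card +
        (X.filter fun x => (∃ y ∈ X, ε (ι x) = ι y) ∧ f (ι x) = false).card := by
      rw [hXi, ← Finset.card_filter_add_card_filter_not (s := X.filter _) (fun x => f (ι x) = true),
        Finset.filter_filter, Finset.filter_filter]
      simp
    rw [e1, e2]; omega
  have hXSR : ∀ S, S ⊆ X → (S ∩ Xi).card + (S ∩ Re).card = S.card := by
    intro S hS
    rw [← Finset.card_filter_add_card_filter_not (s := S) (fun x => (∃ y ∈ X, ε (ι x) = ι y))]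
    congr 2
    · ext y; simp only [hXi, Finset.mem_inter, Finset.mem_filter]
      have := @hS y; tauto
    · ext y; simp only [hRe, Finset.mem_inter, Finset.mem_filter]
      have := @hS y; tauto
  refine ⟨fun S T => ∑ x ∈ Re, if x ∉ S ∧ T = insert x S then (GC v X ι ε ∅ S : ℝ) / p else 0,
    ?_, ?_, ?_⟩
  · intro S T
    refine Finset.sum_nonneg fun x _ => ?_
    split_ifs
    · positivity
    · exact le_rfl
  · intro S hS hk
    rw [Finset.sum_comm]
    have : ∀ x ∈ Re, (∑ T ∈ Finset.univ.filter
          (fun T : Finset (Fin m) => T ⊆ X ∧ T.card = k + 1 ∧ S ⊆ T),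
          if x ∉ S ∧ T = insert x S then (GC v X ι ε ∅ S : ℝ) / p else 0) =
          if x ∉ S then (GC v X ι ε ∅ S : ℝ) / p else 0 := by
      intro x hx
      by_cases hxS : x ∈ S
      · simp [hxS]
      · simp only [hxS, not_false_eq_true, true_and, if_true]
        rw [Finset.sum_ite_eq' , if_pos]
        simp only [Finset.mem_filter, Finset.mem_univ, true_and]
        refine ⟨Finset.insert_subset (hRX x hx) hS, ?_, Finset.subset_insert _ _⟩
        rw [Finset.card_insert_of_notMem hxS, hk]
    rw [Finset.sum_congr rfl this, ← Finset.sum_filter, Finset.sum_const, nsmul_eq_mul]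
    by_cases h0 : GC v X ι ε ∅ S = 0
    · simp [h0]
    · have h1 := hsplit S hS h0
      have h2 := hXSR S hS
      have h3 : (Re.filter fun x => x ∉ S).card + (S ∩ Re).card = Re.card := by
        rw [← Finset.card_filter_add_card_filter_not (s := Re) (fun x => x ∉ S)]
        congr 2
        ext y; simp; tauto
      have h4 : ((Re.filter fun x => x ∉ S).card : ℝ) = p := by
        have : 2 * (Re.filter fun x => x ∉ S).card + Xi.card = 2 * (k + 1) := by omega
        have : 2 * ((Re.filter fun x => x ∉ S).card : ℝ) + Xi.card = 2 * (k + 1) := by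
          exact_mod_cast this
        rw [hp]; linarith
      rw [h4]; field_simp
  · intro T hT hk
    rw [Finset.sum_comm]
    have : ∀ x ∈ Re, (∑ S ∈ Finset.univ.filter
          (fun S : Finset (Fin m) => S ⊆ X ∧ S.card = k ∧ S ⊆ T),
          if x ∉ S ∧ T = insert x S then (GC v X ι ε ∅ S : ℝ) / p else 0) =
          if x ∈ T then (GC v X ι ε ∅ T : ℝ) / p else 0 := by
      intro x hx
      by_cases hxT : x ∈ T
      · rw [Finset.sum_eq_single (T.erase x)]
        · have h1 := flip_base v X ι hι ε hε x (hRX x hx) (hRE x hx) (T.erase x) (by simp)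
          rw [Finset.insert_erase hxT] at h1
          simp [hxT, Finset.insert_erase hxT, h1]
        · intro S _ hne
          rw [if_neg]
          rintro ⟨h1, rfl⟩
          exact hne (by rw [Finset.erase_insert h1])
        · intro h
          exfalso; apply h
          simp only [Finset.mem_filter, Finset.mem_univ, true_and]
          refine ⟨(Finset.erase_subset _ _).trans hT, ?_, Finset.erase_subset _ _⟩
          rw [Finset.card_erase_of_mem hxT, hk]; rfl
      · rw [if_neg hxT]
        apply Finset.sum_eq_zero
        intro S _
        rw [if_neg]
        rintro ⟨_, rfl⟩
        simp at hxT
    rw [Finset.sum_congr rfl this, ← Finset.sum_filter, Finset.sum_const, nsmul_eq_mul]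
    by_cases h0 : GC v X ι ε ∅ T = 0
    · simp [h0]
    · have h1 := hsplit T hT h0
      have h2 := hXSR T hT
      have h3 : (Re.filter fun x => x ∈ T).card = (T ∩ Re).card := by
        congr 1
        ext y; simp; tauto
      have h4 : ((Re.filter fun x => x ∈ T).card : ℝ) = p := by
        have : 2 * (Re.filter fun x => x ∈ T).card + Xi.card = 2 * (k + 1) := by omega
        have : 2 * ((Re.filter fun x => x ∈ T).card : ℝ) + Xi.card = 2 * (k + 1) := by
          exact_mod_cast this
        rw [hp]; linarith
      rw [h4]; field_simp

def mergeE (ε : H → H) (h h' : H) : H → H := fun x =>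
  if x = h then h' else if x = h' then h else if x = ε h then ε h' else if x = ε h' then ε h
  else ε x

lemma mergeE_invol (ε : H → H) (hε : ∀ h, ε (ε h) = h) (hne : ∀ h, ε h ≠ h) (h h' : H) (hh : h ≠ h') :
    (∀ x, mergeE ε h h' (mergeE ε h h' x) = x) ∧ (∀ x, mergeE ε h h' x ≠ x) := by
  have inj : ∀ a b, ε a = ε b → a = b := fun a b e => by rw [← hε a, e, hε]
  constructor
  · intro x
    unfold mergeE
    grind
  · intro x
    unfold mergeE
    grind

lemma merge_iff (ε : H → H) (hε : ∀ h, ε (ε h) = h) (hne : ∀ h, ε h ≠ h) (h h' : H) (hh : h ≠ h')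
    (f : H → Bool) :
    ((∀ x, f (ε x) = !f x) ∧ f h' ≠ f h) ↔
    ((∀ x, f (mergeE ε h h' x) = !f x) ∧ f (ε h) = !f h) := by
  constructor
  · rintro ⟨h1, h2⟩
    refine ⟨fun x => ?_, h1 h⟩
    have h3 : f h' = !f h := by
      cases e1 : f h <;> cases e2 : f h' <;> simp_all
    unfold mergeE
    split_ifs with c1 c2 c3 c4
    · rw [c1, h3]
    · rw [c2, h3]; simp
    · rw [c3, h1, h1, h3]
    · rw [c4, h1, h1, h3]; simp
    · exact h1 x
  · rintro ⟨h1, h2⟩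
    have b3 : f h' = !f h := by simpa [mergeE] using h1 h
    have b4 : f (ε h') = !f h' := by
      by_cases q : ε h = h'
      · rw [← q, hε, h2]; simp
      · have b2 : f (ε h') = !f (ε h) := by simpa [mergeE, hne h, q] using h1 (ε h)
        rw [b2, h2, b3]
    refine ⟨fun x => ?_, by rw [b3]; simp⟩
    by_cases c1 : x = h
    · rw [c1, h2]
    by_cases c2 : x = h'
    · rw [c2, b4]
    by_cases c3 : x = ε h
    · rw [c3, hε, h2]; simp
    by_cases c4 : x = ε h'
    · rw [c4, hε, b4]; simp
    simpa [mergeE, c1, c2, c3, c4] using h1 x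

lemma Bal_remove (v : H → ℕ) (A : Finset H) (h h' : H) (hA : h ∈ A) (hA' : h' ∈ A)
    (hv : v h' = v h) (f : H → Bool) (hf : f h' ≠ f h) :
    Bal v A f ↔ Bal v (A \ {h, h'}) f := by
  have hhne : h ≠ h' := fun e => hf (by rw [e])
  unfold Bal
  refine forall_congr' fun i => ?_
  have e : A = insert h (insert h' (A \ {h, h'})) := by
    ext x; simp; grind
  have n1 : h ∉ insert h' (A \ {h, h'}) := by simp [hhne]
  have n2 : h' ∉ A \ {h, h'} := by simp
  conv_lhs => rw [e]
  simp only [Finset.card_filter]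
  rw [Finset.sum_insert n1, Finset.sum_insert n2, Finset.sum_insert n1, Finset.sum_insert n2, hv]
  clear e n1 n2
  have h3 : f h' = !f h := by
    cases e1 : f h <;> cases e2 : f h' <;> simp_all
  rw [h3]
  by_cases hi : v h = i <;> cases e1 : f h <;> simp [hi] <;> omega

lemma core_count (v : H → ℕ) (X : Finset (Fin m)) (ι : Fin m → H)
    (ε : H → H) (hε : ∀ h, ε (ε h) = h) (hne : ∀ h, ε h ≠ h) (A : Finset H)
    (hAX : ∀ x ∈ X, ι x ∉ A) (h h' : H) (hA : h ∈ A) (hA' : h' ∈ A) (hv : v h' = v h) (hh : h ≠ h') :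
    ∃ c : ℝ, 0 ≤ c ∧ ∀ S, ((Finset.univ.filter fun f : H → Bool =>
      ((∀ h, f (ε h) = !f h) ∧ Bal v A f ∧ outS X ι f = S) ∧ f h' ≠ f h).card : ℝ) =
      c * GC v X ι (mergeE ε h h') (A \ {h, h'}) S := by
  have e1 : ∀ S, (Finset.univ.filter fun f : H → Bool =>
      ((∀ h, f (ε h) = !f h) ∧ Bal v A f ∧ outS X ι f = S) ∧ f h' ≠ f h) = 
      ((Finset.univ.filter fun f : H → Bool =>
      (∀ x, f (mergeE ε h h' x) = !f x) ∧ Bal v (A \ {h, h'}) f ∧ outS X ι f = S).filter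
        fun f => f (ε h) = !f h) := by
    intro S
    ext f
    simp only [Finset.mem_filter, Finset.mem_univ, true_and]
    have a := merge_iff ε hε hne h h' hh f
    have b := Bal_remove v A h h' hA hA' hv f
    have b3 : (∀ x, f (mergeE ε h h' x) = !f x) → f h' ≠ f h := by
      intro q
      have : f h' = !f h := by simpa [mergeE] using q h
      rw [this]; simp
    tauto
  by_cases hc : h' = ε h
  · refine ⟨1, zero_le_one, fun S => ?_⟩
    rw [e1, one_mul, GC, Finset.filter_true_of_mem]
    intro f hf
    simp only [Finset.mem_filter, Finset.mem_univ, true_and] at hf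
    have := hf.1 h
    simpa [mergeE, hc] using this
  · refine ⟨1 / 2, by norm_num, fun S => ?_⟩
    rw [e1, GC]
    set F := (Finset.univ.filter fun f : H → Bool =>
      (∀ x, f (mergeE ε h h' x) = !f x) ∧ Bal v (A \ {h, h'}) f ∧ outS X ι f = S) with hF
    have hflip : ∀ f ∈ F, flipOn {h, h'} f ∈ F := by
      intro f hf
      simp only [hF, Finset.mem_filter, Finset.mem_univ, true_and] at hf ⊢
      refine ⟨flipOn_valid _ _ ?_ _ hf.1, ?_, ?_⟩
      · have inj : ∀ a b, ε a = ε b → a = b := fun a b e => by rw [← hε a, e, hε]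
        intro x
        simp only [Finset.mem_insert, Finset.mem_singleton]
        unfold mergeE
        grind
      · refine Bal_congr v _ f _ ?_ hf.2.1
        intro x hx
        have : x ∉ ({h, h'} : Finset H) := (Finset.mem_sdiff.1 hx).2
        simp [flipOn, this]
      · rw [← hf.2.2]
        unfold outS
        refine Finset.filter_congr fun x hx => ?_
        have : ι x ∉ ({h, h'} : Finset H) := by
          have := hAX x hx
          simp only [Finset.mem_insert, Finset.mem_singleton]
          rintro (q | q) <;> rw [q] at this <;> contradiction
        simp only [flipOn, this, if_false]
    have hval : ∀ f : H → Bool, flipOn {h, h'} f (ε h) = f (ε h) ∧ flipOn {h, h'} f h = !f h := by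
      intro f
      have : ε h ∉ ({h, h'} : Finset H) := by
        simp only [Finset.mem_insert, Finset.mem_singleton]
        rintro (q | q)
        · exact hne h q
        · exact hc q.symm
      constructor
      · simp only [flipOn, this, if_false]
      · simp [flipOn]
    have heq : (F.filter fun f => f (ε h) = !f h).card = (F.filter fun f => ¬ f (ε h) = !f h).card := by
      refine Finset.card_nbij' (flipOn {h, h'}) (flipOn {h, h'}) ?_ ?_ ?_ ?_
      · intro f hf
        simp only [Finset.coe_filter, Set.mem_ofPred_eq] at hf ⊢
        refine ⟨hflip f hf.1, ?_⟩
        rw [(hval f).1, (hval f).2, hf.2]; simp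
      · intro f hf
        simp only [Finset.coe_filter, Set.mem_ofPred_eq] at hf ⊢
        refine ⟨hflip f hf.1, ?_⟩
        rw [(hval f).1, (hval f).2]
        simpa using hf.2
      · intro f _; exact flipOn_flipOn _ _
      · intro f _; exact flipOn_flipOn _ _
    have htot := Finset.card_filter_add_card_filter_not (s := F) (fun f => f (ε h) = !f h)
    rw [← htot, ← heq]; push_cast; ring

lemma core (v : H → ℕ) (X : Finset (Fin m)) (k : ℕ) (hX : X.card = 2 * k + 1)
    (ι : Fin m → H) (hι : Function.Injective ι) : ∀ (N : ℕ) (A : Finset H), A.card = N →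
    (∀ x ∈ X, ι x ∉ A) → ∀ (ε : H → H), (∀ h, ε (ε h) = h) → (∀ h, ε h ≠ h) →
    NMPB X k (fun S => (GC v X ι ε A S : ℝ)) := by
  intro N
  induction N using Nat.strong_induction_on with
  | _ N ih =>
  intro A hAN hAX ε hε hne
  rcases A.eq_empty_or_nonempty with rfl | ⟨h, hA⟩
  · exact core_base v X k hX ι hι ε hε
  set B := A.filter fun x => v x = v h with hB
  have hhB : h ∈ B := by simp [hB, hA]
  have hB0 : (0 : ℝ) < B.card := by exact_mod_cast Finset.card_pos.2 ⟨h, hhB⟩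
  have hB1 : ∀ h' ∈ B.erase h, h' ∈ A ∧ v h' = v h ∧ h ≠ h' := by
    intro h' q
    simp only [hB, Finset.mem_erase, Finset.mem_filter] at q
    exact ⟨q.2.1, q.2.2, Ne.symm q.1⟩
  have hex : ∀ h', ∃ c : ℝ, h' ∈ B.erase h → 0 ≤ c ∧ ∀ S, ((Finset.univ.filter fun f : H → Bool =>
      ((∀ h, f (ε h) = !f h) ∧ Bal v A f ∧ outS X ι f = S) ∧ f h' ≠ f h).card : ℝ) =
      c * GC v X ι (mergeE ε h h') (A \ {h, h'}) S := by
    intro h'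
    by_cases q : h' ∈ B.erase h
    · obtain ⟨q1, q2, q3⟩ := hB1 h' q
      obtain ⟨c, hc⟩ := core_count v X ι ε hε hne A hAX h h' hA q1 q2 q3
      exact ⟨c, fun _ => hc⟩
    · exact ⟨0, fun w => absurd w q⟩
  choose c hc using hex
  have hmain : NMPB X k (fun S => ∑ h' ∈ B.erase h, c h' *
      (GC v X ι (mergeE ε h h') (A \ {h, h'}) S : ℝ)) := by
    refine NMPB_sum _ c _ (fun h' q => (hc h' q).1) fun h' q => ?_
    obtain ⟨q1, q2, q3⟩ := hB1 h' q
    obtain ⟨i1, i2⟩ := mergeE_invol ε hε hne h h' q3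
    refine ih (A \ {h, h'}).card ?_ _ rfl ?_ _ i1 i2
    · rw [← hAN]
      refine Finset.card_lt_card ⟨Finset.sdiff_subset, fun w => ?_⟩
      have := w hA
      simp at this
    · intro x hx w
      exact hAX x hx (Finset.sdiff_subset w)
  have hfin := NMPB_smul (2 / (B.card : ℝ)) _ (by positivity) hmain
  convert hfin using 2 with S
  rw [Finset.sum_congr rfl fun h' q => ((hc h' q).2 S).symm]
  have hdc : ∑ h' ∈ B.erase h, (Finset.univ.filter fun f : H → Bool =>
      ((∀ h, f (ε h) = !f h) ∧ Bal v A f ∧ outS X ι f = S) ∧ f h' ≠ f h).card * 2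
      = GC v X ι ε A S * B.card := by
    unfold GC
    rw [← Finset.sum_mul]
    simp only [← Finset.filter_filter (fun f : H → Bool => (∀ h, f (ε h) = !f h) ∧ Bal v A f ∧ outS X ι f = S)]
    simp only [Finset.card_filter (fun f : H → Bool => f _ ≠ f h)]
    rw [Finset.sum_comm, Finset.sum_mul, Finset.card_eq_sum_ones, Finset.sum_mul]
    refine Finset.sum_congr rfl fun f hf => ?_
    simp only [Finset.mem_filter, Finset.mem_univ, true_and] at hf
    have hb := hf.2.1 (v h)
    rw [← Finset.card_filter]
    have e1 : ∀ b, f h = b → (B.erase h).filter (fun h' => f h' ≠ f h) =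
        A.filter fun x => v x = v h ∧ f x = !b := by
      intro b hb
      ext y
      simp only [hB, Finset.mem_filter, Finset.mem_erase, hb]
      constructor
      · rintro ⟨⟨q1, q2, q3⟩, q4⟩
        exact ⟨q2, q3, by cases b <;> simp_all⟩
      · rintro ⟨q1, q2, q3⟩
        refine ⟨⟨?_, q1, q2⟩, by rw [q3]; simp⟩
        rintro rfl
        rw [hb] at q3
        simp at q3
    have e2 : B.card = (A.filter fun x => v x = v h ∧ f x = true).card +
        (A.filter fun x => v x = v h ∧ f x = false).card := by
      rw [hB, ← Finset.card_filter_add_card_filter_not (s := A.filter _) (fun x => f x = true),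
        Finset.filter_filter, Finset.filter_filter]
      simp
    rw [e1 _ rfl, e2]
    cases f h
    · simp only [Bool.not_false]; omega
    · simp only [Bool.not_true]; omega
  have hdc' : (∑ h' ∈ B.erase h, ((Finset.univ.filter fun f : H → Bool =>
      ((∀ h, f (ε h) = !f h) ∧ Bal v A f ∧ outS X ι f = S) ∧ f h' ≠ f h).card : ℝ)) * 2
      = GC v X ι ε A S * B.card := by
    rw [Finset.sum_mul]
    exact_mod_cast hdc
  field_simp
  linarith
end core

section final
variable {m : ℕ}

def vv (ga gb : Fin m → ℕ) : Fin m × Bool → ℕ := fun h => if h.2 = true then ga h.1 else gb h.1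
def eps : Fin m × Bool → Fin m × Bool := fun h => (h.1, !h.2)
def ph (O : Fin m → Bool) : Fin m × Bool → Bool := fun h => O h.1 == h.2
def iot (ga : Fin m → ℕ) (n : ℕ) : Fin m → Fin m × Bool := fun j => (j, decide (ga j = n))
def AA (ga gb : Fin m → ℕ) (d : ℕ) : Finset (Fin m × Bool) :=
  Finset.univ.filter fun h => 1 ≤ vv ga gb h ∧ vv ga gb h ≤ d

lemma mem_AA (ga gb : Fin m → ℕ) (d : ℕ) (h : Fin m × Bool) :
    h ∈ AA ga gb d ↔ 1 ≤ vv ga gb h ∧ vv ga gb h ≤ d := by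
  simp only [AA, Finset.mem_filter, Finset.mem_univ, true_and]

lemma deg_eq (ga gb : Fin m → ℕ) (O : Fin m → Bool) (i : ℕ) :
    (outAt ga gb O i).card + (inAt ga gb O i).card = degAt ga gb i := by
  unfold outAt inAt degAt
  simp only [Finset.card_filter]
  rw [← Finset.sum_add_distrib, ← Finset.sum_add_distrib]
  refine Finset.sum_congr rfl fun j _ => ?_
  cases O j <;> simp [add_comm]

lemma out_card (ga gb : Fin m → ℕ) (d : ℕ) (O : Fin m → Bool) (i : ℕ) (h1 : 1 ≤ i) (h2 : i ≤ d) :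
    ((AA ga gb d).filter fun h => vv ga gb h = i ∧ ph O h = true).card = (outAt ga gb O i).card := by
  refine Finset.card_nbij' (fun h => h.1) (fun j => (j, O j)) ?_ ?_ ?_ ?_
  · rintro ⟨j, b⟩ h
    simp only [mem_AA, vv, ph, outAt, Finset.coe_filter, Finset.mem_filter, Finset.mem_univ, true_and,
      Set.mem_ofPred_eq, beq_iff_eq] at h ⊢
    obtain ⟨-, h3, rfl⟩ := h
    cases hO : O j <;> simp_all
  · intro j h
    simp only [mem_AA, vv, ph, outAt, Finset.coe_filter, Finset.mem_filter, Finset.mem_univ, true_and,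
      Set.mem_ofPred_eq, beq_iff_eq] at h ⊢
    cases hO : O j <;> simp_all [Finset.mem_filter]
  · rintro ⟨j, b⟩ h
    simp only [ph, Finset.coe_filter, Set.mem_ofPred_eq, beq_iff_eq] at h
    simp [h.2.2]
  · intro j _; rfl

lemma in_card (ga gb : Fin m → ℕ) (d : ℕ) (O : Fin m → Bool) (i : ℕ) (h1 : 1 ≤ i) (h2 : i ≤ d) :
    ((AA ga gb d).filter fun h => vv ga gb h = i ∧ ph O h = false).card = (inAt ga gb O i).card := by
  have key : ∀ p q : Bool, (p == q) = false ↔ q = !p := by decide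
  refine Finset.card_nbij' (fun h => h.1) (fun j => (j, !O j)) ?_ ?_ ?_ ?_
  · rintro ⟨j, b⟩ h
    simp only [mem_AA, vv, ph, inAt, Finset.coe_filter, Finset.mem_filter, Finset.mem_univ, true_and,
      Set.mem_ofPred_eq, key] at h ⊢
    obtain ⟨-, h3, rfl⟩ := h
    cases hO : O j <;> simp_all
  · intro j h
    simp only [mem_AA, vv, ph, inAt, Finset.coe_filter, Finset.mem_filter, Finset.mem_univ, true_and,
      Set.mem_ofPred_eq, key] at h ⊢
    cases hO : O j <;> simp_all [Finset.mem_filter]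
  · rintro ⟨j, b⟩ h
    simp only [ph, Finset.coe_filter, Set.mem_ofPred_eq, key] at h
    simp [h.2.2]
  · intro j _; rfl

lemma bal_iff (ga gb : Fin m → ℕ) (d : ℕ) (a : ℕ → ℕ)
    (hdeg : ∀ i, 1 ≤ i → i ≤ d → degAt ga gb i = 2 * a i) (O : Fin m → Bool) :
    Bal (vv ga gb) (AA ga gb d) (ph O) ↔
    ∀ i : ℕ, 1 ≤ i → i ≤ d → (outAt ga gb O i).card = a i ∧ (inAt ga gb O i).card = a i := by
  constructor
  · intro h i h1 h2
    have := h i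
    rw [out_card ga gb d O i h1 h2, in_card ga gb d O i h1 h2] at this
    have e := deg_eq ga gb O i
    rw [hdeg i h1 h2] at e
    omega
  · intro h i
    by_cases hi : 1 ≤ i ∧ i ≤ d
    · rw [out_card ga gb d O i hi.1 hi.2, in_card ga gb d O i hi.1 hi.2,
        (h i hi.1 hi.2).1, (h i hi.1 hi.2).2]
    · rw [Finset.filter_false_of_mem, Finset.filter_false_of_mem]
      · intro x hx
        simp only [AA, Finset.mem_filter, Finset.mem_univ, true_and] at hx
        rintro ⟨rfl, -⟩
        exact hi hx
      · intro x hx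
        simp only [AA, Finset.mem_filter, Finset.mem_univ, true_and] at hx
        rintro ⟨rfl, -⟩
        exact hi hx

lemma out_iff (ga gb : Fin m → ℕ) (n : ℕ) (hloop : ¬ ∃ j, ga j = n ∧ gb j = n)
    (O : Fin m → Bool) (S : Finset (Fin m)) :
    outS (edgesAt ga gb n) (iot ga n) (ph O) = S ↔
    (outAt ga gb O n = S ∧ inAt ga gb O n = edgesAt ga gb n \ S) := by
  have e1 : outS (edgesAt ga gb n) (iot ga n) (ph O) = outAt ga gb O n := by
    ext j
    simp only [outS, edgesAt, iot, ph, outAt, Finset.mem_filter, Finset.mem_univ, true_and, beq_iff_eq]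
    have : ¬ (ga j = n ∧ gb j = n) := fun h => hloop ⟨j, h⟩
    cases O j <;> by_cases h1 : ga j = n <;> by_cases h2 : gb j = n <;> simp_all
  have e2 : inAt ga gb O n = edgesAt ga gb n \ outAt ga gb O n := by
    ext j
    simp only [edgesAt, inAt, outAt, Finset.mem_filter, Finset.mem_univ, true_and, Finset.mem_sdiff]
    have : ¬ (ga j = n ∧ gb j = n) := fun h => hloop ⟨j, h⟩
    cases O j <;> by_cases h1 : ga j = n <;> by_cases h2 : gb j = n <;> simp_all
  rw [e1, e2]
  constructor
  · rintro rfl; exact ⟨rfl, rfl⟩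
  · exact fun h => h.1

def nrm (ga gb : Fin m → ℕ) (O : Fin m → Bool) : Fin m → Bool :=
  fun j => if ga j = gb j then false else O j

lemma out_nrm (ga gb : Fin m → ℕ) (O : Fin m → Bool) (i : ℕ) :
    outAt ga gb (nrm ga gb O) i = outAt ga gb O i := by
  ext j
  simp only [outAt, nrm, Finset.mem_filter, Finset.mem_univ, true_and]
  by_cases h : ga j = gb j <;> cases hO : O j <;> simp [h, hO]

lemma in_nrm (ga gb : Fin m → ℕ) (O : Fin m → Bool) (i : ℕ) :
    inAt ga gb (nrm ga gb O) i = inAt ga gb O i := by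
  ext j
  simp only [inAt, nrm, Finset.mem_filter, Finset.mem_univ, true_and]
  by_cases h : ga j = gb j <;> cases hO : O j <;> simp [h, hO]

lemma GC_eq (n : ℕ) (ga gb : Fin m → ℕ) (d : ℕ) (a : ℕ → ℕ)
    (hloop : ¬ ∃ j, ga j = n ∧ gb j = n)
    (hdeg : ∀ i, 1 ≤ i → i ≤ d → degAt ga gb i = 2 * a i) (S : Finset (Fin m)) :
    GC (vv ga gb) (edgesAt ga gb n) (iot ga n) eps (AA ga gb d) S =
      MballW n ga gb d a S * ∏ j : Fin m, (if ga j = gb j then 2 else 1) := by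
  set P : (Fin m → Bool) → Prop := fun O =>
    (∀ i : ℕ, 1 ≤ i → i ≤ d → (outAt ga gb O i).card = a i ∧ (inAt ga gb O i).card = a i) ∧
    outAt ga gb O n = S ∧ inAt ga gb O n = edgesAt ga gb n \ S with hP
  have hPn : ∀ O, P (nrm ga gb O) ↔ P O := by
    intro O
    simp only [hP, out_nrm, in_nrm]
  have e1 : GC (vv ga gb) (edgesAt ga gb n) (iot ga n) eps (AA ga gb d) S =
      (Finset.univ.filter P).card := by
    unfold GC
    have hpp : ∀ f : Fin m × Bool → Bool, (∀ h, f (eps h) = !f h) → ph (fun j => f (j, true)) = f := by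
      intro f hf
      funext ⟨j, b⟩
      have := hf (j, true)
      simp only [eps, Bool.not_true] at this
      cases b <;> simp [ph, this]
    refine Finset.card_nbij' (fun f j => f (j, true)) ph ?_ ?_ ?_ ?_
    · intro f hf
      simp only [Finset.coe_filter, Finset.mem_univ, true_and, Set.mem_ofPred_eq] at hf ⊢
      rw [hP]
      beta_reduce
      rw [← bal_iff ga gb d a hdeg, ← out_iff ga gb n hloop, hpp f hf.1]
      exact hf.2
    · intro O hO
      simp only [Finset.coe_filter, Finset.mem_univ, true_and, Set.mem_ofPred_eq] at hO ⊢
      rw [hP] at hO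
      beta_reduce at hO
      rw [← bal_iff ga gb d a hdeg, ← out_iff ga gb n hloop] at hO
      refine ⟨?_, hO⟩
      rintro ⟨j, b⟩
      simp only [ph, eps]
      cases O j <;> cases b <;> rfl
    · intro f hf
      simp only [Finset.coe_filter, Finset.mem_univ, true_and, Set.mem_ofPred_eq] at hf
      exact hpp f hf.1
    · intro O _
      funext j
      simp [ph]
  have e2 : MballW n ga gb d a S =
      (Finset.univ.filter fun O : Fin m → Bool => (∀ j, ga j = gb j → O j = false) ∧ P O).card := rfl
  rw [e1, e2, Finset.card_eq_sum_card_fiberwise (f := nrm ga gb)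
    (t := Finset.univ.filter fun O : Fin m → Bool => (∀ j, ga j = gb j → O j = false) ∧ P O)]
  · rw [Finset.sum_const_nat]
    intro b hb
    simp only [Finset.mem_filter, Finset.mem_univ, true_and] at hb
    have : (Finset.univ.filter P).filter (fun O => nrm ga gb O = b) =
        Fintype.piFinset (fun j => if ga j = gb j then (Finset.univ : Finset Bool) else {b j}) := by
      ext O
      simp only [Finset.mem_filter, Finset.mem_univ, true_and, Fintype.mem_piFinset]
      constructor
      · rintro ⟨-, rfl⟩ j
        by_cases h : ga j = gb j <;> simp [nrm, h]
      · intro h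
        have hn : nrm ga gb O = b := by
          funext j
          have := h j
          by_cases h' : ga j = gb j
          · simp [nrm, h', hb.1 j h']
          · simpa [nrm, h'] using this
        refine ⟨?_, hn⟩
        rw [← hPn, hn]; exact hb.2
    rw [this, Fintype.card_piFinset]
    refine Finset.prod_congr rfl fun j _ => ?_
    split_ifs <;> simp
  · intro O hO
    simp only [Finset.coe_filter, Finset.mem_univ, true_and, Set.mem_ofPred_eq] at hO ⊢
    exact ⟨fun j hj => by simp [nrm, hj], (hPn O).2 hO⟩

end final

/-- (Lemma 4.1) `H_X` with the weight `M_{G,a}` satisfies (NMP-B), where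
`a = (a_1,…,a_d)` is encoded as `a : ℕ → ℕ`. -/
theorem lem_4_1 (n : ℕ) (hn : 1 ≤ n) (m : ℕ) (ga gb : Fin m → ℕ)
    (hga : ∀ j, 1 ≤ ga j ∧ ga j ≤ n) (hgb : ∀ j, 1 ≤ gb j ∧ gb j ≤ n)
    (d : ℕ) (hd : d ≤ n - 1) (a : ℕ → ℕ)
    (k : ℕ) (hX : (edgesAt ga gb n).card = 2 * k + 1) :
    NMPB (edgesAt ga gb n) k (fun S => (MballW n ga gb d a S : ℝ)) := by
  by_cases hloop : ∃ j, ga j = n ∧ gb j = n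
  · obtain ⟨j, h1, h2⟩ := hloop
    have : (fun S => (MballW n ga gb d a S : ℝ)) = fun _ => 0 := by
      funext S
      rw [Nat.cast_eq_zero, MballW, Finset.card_eq_zero]
      apply Finset.filter_false_of_mem
      rintro O - ⟨-, -, h3, h4⟩
      have q1 : j ∈ outAt ga gb O n := by
        simp only [outAt, Finset.mem_filter, Finset.mem_univ, true_and, h1, h2]
        cases O j <;> simp
      have q2 : j ∈ inAt ga gb O n := by
        simp only [inAt, Finset.mem_filter, Finset.mem_univ, true_and, h1, h2]
        cases O j <;> simp
      rw [h3] at q1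
      rw [h4] at q2
      exact (Finset.mem_sdiff.1 q2).2 q1
    rw [this]
    exact NMPB_zero
  by_cases hdeg : ∀ i, 1 ≤ i → i ≤ d → degAt ga gb i = 2 * a i
  · have hc := core (vv ga gb) (edgesAt ga gb n) k hX (iot ga n)
      (fun x y h => congrArg Prod.fst h) _ (AA ga gb d) rfl ?_ eps
      (by rintro ⟨j, b⟩; simp [eps]) (by rintro ⟨j, b⟩; cases b <;> simp [eps])
    · have hC : (0 : ℝ) < ((∏ j : Fin m, (if ga j = gb j then 2 else 1) : ℕ) : ℝ) := by
        rw [Nat.cast_pos]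
        apply Finset.prod_pos
        intro j _
        split_ifs <;> norm_num
      have := NMPB_smul (((∏ j : Fin m, (if ga j = gb j then 2 else 1) : ℕ) : ℝ)⁻¹) _ (by positivity) hc
      convert this using 2 with S
      rw [GC_eq n ga gb d a hloop hdeg S]
      rw [Nat.cast_mul]
      field_simp
    · intro x hx h
      simp only [AA, Finset.mem_filter, Finset.mem_univ, true_and] at h
      have : vv ga gb (iot ga n x) = n := by
        simp only [edgesAt, Finset.mem_filter, Finset.mem_univ, true_and] at hx
        by_cases q : ga x = n
        · simp [vv, iot, q]
        · simp only [q, false_or] at hx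
          simp [vv, iot, q, hx]
      omega
  · have : (fun S => (MballW n ga gb d a S : ℝ)) = fun _ => 0 := by
      funext S
      rw [Nat.cast_eq_zero, MballW, Finset.card_eq_zero]
      apply Finset.filter_false_of_mem
      rintro O - ⟨-, h2, -⟩
      apply hdeg
      intro i hi hi'
      have := h2 i hi hi'
      rw [← deg_eq ga gb O i]
      omega
    rw [this]
    exact NMPB_zero
end

section
/- (Lemma 4.3, vertex splitting) Let 1 ≤ d ≤ n−1 and a = (a_1,…,a_d) ∈ ℕ^d with a_d ≥ 1, and suppose no loops of G are incident to v_d and deg_G(v_d) = 2a_d. Let Y_d be the set of (indices of) edges incident to v_d, and let PM(Y_d) be the set of perfect matchings of Y_d, i.e., partitions of Y_d into a_d unordered pairs. Then for every S ⊆ X, a_d! · M_{G,a}(S) = Σ_{π ∈ PM(Y_d)} M_{G[π], a'}(S), where a' = (a_1,…,a_{d−1}, 1, 1, …, 1) ∈ ℕ^{d+a_d−1} (the entry 1 repeated a_d times). -/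
open Finset
open scoped Classical

/-- Relabeling of an old vertex `k ≠ d` under the `π`-split of `v_d` into `aD`
new vertices inserted immediately after `v_{d-1}`: labels `< d` are unchanged
and labels `> d` shift up by `aD − 1`. -/
def splitLabel (d aD k : ℕ) : ℕ := if k < d then k else k + aD - 1

/-- The index `t ∈ {1,…,a_d}` of the pair of `π` containing the edge `j`, when
the pairs `P_1,…,P_{a_d}` are ordered by their minimal edge index. -/
def pairIdx {m : ℕ} (Yd : Finset (Fin m)) (π : Fin m → Fin m) (j : Fin m) : ℕ :=
  1 + (Yd.filter fun e => e < π e ∧ e < min j (π j)).card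

theorem aux_count {m : ℕ} (A B : Finset (Fin m)) (hAB : Disjoint A B) (k : ℕ)
    (hA : A.card = k) (hB : B.card = k) :
    (Finset.univ.filter (fun π : Fin m → Fin m =>
      ((∀ j ∈ A ∪ B, π j ∈ A ∪ B ∧ π j ≠ j ∧ π (π j) = j) ∧ (∀ j, j ∉ A ∪ B → π j = j)) ∧
      (∀ j ∈ A, π j ∈ B) ∧ (∀ j ∈ B, π j ∈ A))).card = Nat.factorial k := by
  have hdis : ∀ x, x ∈ A → x ∈ B → False := fun x h1 h2 => (Finset.disjoint_left.mp hAB) h1 h2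
  have e0 : A ≃ B := Fintype.equivOfCardEq (by simp [hA, hB])
  have hc : Fintype.card (A ≃ B) = Nat.factorial k := by
    rw [Fintype.card_equiv e0]; simp [hA]
  rw [← hc, ← Finset.card_univ]
  symm
  refine Finset.card_bij (fun (σ : A ≃ B) _ => fun x : Fin m =>
    if h : x ∈ A then (σ ⟨x, h⟩ : Fin m) else if h : x ∈ B then (σ.symm ⟨x, h⟩ : Fin m) else x)
    ?_ ?_ ?_
  · intro σ _
    have gen : ∀ f : Fin m → Fin m, (∀ x (h : x ∈ A), f x = σ ⟨x, h⟩) →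
        (∀ x (h : x ∈ B), f x = σ.symm ⟨x, h⟩) → (∀ x, x ∉ A → x ∉ B → f x = x) →
        ((∀ j ∈ A ∪ B, f j ∈ A ∪ B ∧ f j ≠ j ∧ f (f j) = j) ∧ (∀ j, j ∉ A ∪ B → f j = j)) ∧
          (∀ j ∈ A, f j ∈ B) ∧ (∀ j ∈ B, f j ∈ A) := by
      intro f key1 key2 key3
      refine ⟨⟨?_, ?_⟩, ?_, ?_⟩
      · intro j hj
        rcases Finset.mem_union.mp hj with h | h
        · have hm := (σ ⟨j, h⟩).2
          rw [key1 j h]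
          refine ⟨Finset.mem_union_right _ hm, fun e => hdis j h (e ▸ hm), ?_⟩
          rw [key2 _ hm]; simp
        · have hm := (σ.symm ⟨j, h⟩).2
          rw [key2 j h]
          refine ⟨Finset.mem_union_left _ hm, fun e => hdis j (e ▸ hm) h, ?_⟩
          rw [key1 _ hm]; simp
      · intro j hj
        rw [Finset.mem_union, not_or] at hj
        exact key3 j hj.1 hj.2
      · intro j h
        rw [key1 j h]; exact (σ ⟨j, h⟩).2
      · intro j h
        rw [key2 j h]; exact (σ.symm ⟨j, h⟩).2
    refine Finset.mem_filter.mpr ⟨Finset.mem_univ _, gen _ ?_ ?_ ?_⟩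
    · intro x h; simp [h]
    · intro x h
      have : x ∉ A := fun h' => hdis x h' h
      simp [h, this]
    · intro x h h'
      simp [h, h']
  · intro σ _ τ _ h
    ext ⟨x, hx⟩
    have := congrFun h x
    simp only [hx, dif_pos] at this
    rw [this]
  · intro π hπ
    simp only [Finset.mem_filter, Finset.mem_univ, true_and] at hπ
    obtain ⟨⟨h1, h2⟩, h3, h4⟩ := hπ
    refine ⟨⟨fun x => ⟨π x, h3 x x.2⟩, fun x => ⟨π x, h4 x x.2⟩, ?_, ?_⟩, Finset.mem_univ _, ?_⟩
    · intro x; ext; simp [(h1 x (Finset.mem_union_left _ x.2)).2.2]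
    · intro x; ext; simp [(h1 x (Finset.mem_union_right _ x.2)).2.2]
    · funext x
      by_cases hA : x ∈ A
      · simp [hA]
      · by_cases hB : x ∈ B
        · simp [hA, hB]
        · simp [hA, hB, h2 x (by simp [hA, hB])]


theorem aux_cardM {m : ℕ} (Y : Finset (Fin m)) (π : Fin m → Fin m) (k : ℕ)
    (hY : Y.card = 2 * k) (hπ : ∀ j ∈ Y, π j ∈ Y ∧ π j ≠ j ∧ π (π j) = j) :
    (Y.filter fun e => e < π e).card = k := by
  have h1 := Finset.card_filter_add_card_filter_not (s := Y) (fun e => e < π e)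
  have h2 : (Y.filter fun e => e < π e).card = (Y.filter fun e => ¬ e < π e).card := by
    refine Finset.card_bij' (fun e _ => π e) (fun e _ => π e) ?_ ?_ ?_ ?_
    · intro e he
      simp only [Finset.mem_filter] at he ⊢
      obtain ⟨q1, q2, q3⟩ := hπ e he.1
      exact ⟨q1, by rw [q3]; exact not_lt.mpr he.2.le⟩
    · intro e he
      simp only [Finset.mem_filter] at he ⊢
      obtain ⟨q1, q2, q3⟩ := hπ e he.1
      exact ⟨q1, by rw [q3]; exact lt_of_le_of_ne (not_lt.mp he.2) q2⟩
    · intro e he; exact (hπ e (Finset.mem_filter.mp he).1).2.2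
    · intro e he; exact (hπ e (Finset.mem_filter.mp he).1).2.2
  omega

theorem aux_minmem {m : ℕ} (Y : Finset (Fin m)) (π : Fin m → Fin m)
    (hπ : ∀ j ∈ Y, π j ∈ Y ∧ π j ≠ j ∧ π (π j) = j) (j : Fin m) (hj : j ∈ Y) :
    min j (π j) ∈ Y ∧ min j (π j) < π (min j (π j)) := by
  obtain ⟨q1, q2, q3⟩ := hπ j hj
  rcases lt_or_gt_of_ne q2 with h | h
  · rw [min_eq_right h.le, q3]; exact ⟨q1, h⟩
  · rw [min_eq_left h.le]; exact ⟨hj, h⟩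

theorem aux_idx_lt {m : ℕ} (Y : Finset (Fin m)) (π : Fin m → Fin m)
    (hπ : ∀ j ∈ Y, π j ∈ Y ∧ π j ≠ j ∧ π (π j) = j) (j l : Fin m) (hj : j ∈ Y)
    (h : min j (π j) < min l (π l)) : pairIdx Y π j < pairIdx Y π l := by
  unfold pairIdx
  have hm := aux_minmem Y π hπ j hj
  refine Nat.add_lt_add_left (Finset.card_lt_card ?_) 1
  rw [Finset.ssubset_iff_of_subset]
  · exact ⟨min j (π j), by simp only [Finset.mem_filter]; exact ⟨hm.1, hm.2, h⟩, by simp only [Finset.mem_filter]; exact fun h => lt_irrefl _ h.2.2⟩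
  · intro e he
    simp only [Finset.mem_filter] at he ⊢
    exact ⟨he.1, he.2.1, he.2.2.trans h⟩

theorem aux_idx_eq {m : ℕ} (Y : Finset (Fin m)) (π : Fin m → Fin m)
    (hπ : ∀ j ∈ Y, π j ∈ Y ∧ π j ≠ j ∧ π (π j) = j) (j l : Fin m) (hj : j ∈ Y) (hl : l ∈ Y) :
    pairIdx Y π l = pairIdx Y π j ↔ l = j ∨ l = π j := by
  constructor
  · intro h
    have h1 : min j (π j) = min l (π l) := by
      rcases lt_trichotomy (min j (π j)) (min l (π l)) with h' | h' | h'
      · have := aux_idx_lt Y π hπ j l hj h'; omega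
      · exact h'
      · have := aux_idx_lt Y π hπ l j hl h'; omega
    have q := (hπ j hj).2.2
    have q' := (hπ l hl).2.2
    rcases min_choice j (π j) with a | a <;> rcases min_choice l (π l) with b | b <;>
      rw [a, b] at h1
    · exact Or.inl h1.symm
    · right; rw [h1, q']
    · exact Or.inr h1.symm
    · left; rw [← q, h1, q']
  · rintro (h | h)
    · rw [h]
    · unfold pairIdx
      rw [h, (hπ j hj).2.2, min_comm]

theorem aux_idx_range {m : ℕ} (Y : Finset (Fin m)) (π : Fin m → Fin m) (k : ℕ)
    (hY : Y.card = 2 * k) (hπ : ∀ j ∈ Y, π j ∈ Y ∧ π j ≠ j ∧ π (π j) = j)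
    (j : Fin m) (hj : j ∈ Y) : 1 ≤ pairIdx Y π j ∧ pairIdx Y π j ≤ k := by
  have hm := aux_minmem Y π hπ j hj
  have : (Y.filter fun e => e < π e ∧ e < min j (π j)).card < (Y.filter fun e => e < π e).card := by
    apply Finset.card_lt_card
    rw [Finset.ssubset_iff_of_subset]
    · exact ⟨min j (π j), by simp only [Finset.mem_filter]; exact hm, by simp only [Finset.mem_filter]; exact fun h => lt_irrefl _ h.2.2⟩
    · intro e he
      simp only [Finset.mem_filter] at he ⊢
      exact ⟨he.1, he.2.1⟩
  rw [aux_cardM Y π k hY hπ] at this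
  unfold pairIdx
  omega

theorem aux_idx_surj {m : ℕ} (Y : Finset (Fin m)) (π : Fin m → Fin m) (k : ℕ)
    (hY : Y.card = 2 * k) (hπ : ∀ j ∈ Y, π j ∈ Y ∧ π j ≠ j ∧ π (π j) = j)
    (t : ℕ) (h1 : 1 ≤ t) (h2 : t ≤ k) : ∃ j ∈ Y, pairIdx Y π j = t := by
  have himg : (Y.filter fun e => e < π e).image (pairIdx Y π) = Finset.Icc 1 k := by
    apply Finset.eq_of_subset_of_card_le
    · intro x hx
      obtain ⟨j, hj, rfl⟩ := Finset.mem_image.mp hx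
      exact Finset.mem_Icc.mpr (aux_idx_range Y π k hY hπ j (Finset.mem_filter.mp hj).1)
    · rw [Finset.card_image_of_injOn, aux_cardM Y π k hY hπ]
      · simp
      · intro x hx y hy hxy
        simp only [Finset.coe_filter, Set.mem_setOf_eq] at hx hy
        rcases (aux_idx_eq Y π hπ y x hy.1 hx.1).mp hxy with h | h
        · exact h
        · have := hx.2
          rw [h, (hπ y hy.1).2.2] at this
          exact absurd this (not_lt.mpr hy.2.le)
  have : t ∈ (Y.filter fun e => e < π e).image (pairIdx Y π) := by
    rw [himg]; exact Finset.mem_Icc.mpr ⟨h1, h2⟩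
  obtain ⟨j, hj, h⟩ := Finset.mem_image.mp this
  exact ⟨j, (Finset.mem_filter.mp hj).1, h⟩

/-- local condition at new vertices iff the matching swaps out- and in-edges. -/
theorem aux_swap {m : ℕ} (A B : Finset (Fin m)) (hAB : Disjoint A B)
    (π : Fin m → Fin m) (k : ℕ) (hY : (A ∪ B).card = 2 * k)
    (hπ : ∀ j ∈ A ∪ B, π j ∈ A ∪ B ∧ π j ≠ j ∧ π (π j) = j) :
    (∀ t, 1 ≤ t → t ≤ k → (A.filter fun j => pairIdx (A ∪ B) π j = t).card = 1 ∧
        (B.filter fun j => pairIdx (A ∪ B) π j = t).card = 1) ↔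
      (∀ j ∈ A, π j ∈ B) ∧ (∀ j ∈ B, π j ∈ A) := by
  have hdis : ∀ x, x ∈ A → x ∈ B → False := fun x h1 h2 => (Finset.disjoint_left.mp hAB) h1 h2
  constructor
  · intro h
    have main : ∀ j ∈ A ∪ B, ∀ C : Finset (Fin m),
        (C.filter fun l => pairIdx (A ∪ B) π l = pairIdx (A ∪ B) π j).card = 1 →
        j ∈ C → π j ∈ C → False := by
      intro j hj C hC h1 h2
      obtain ⟨q1, q2, q3⟩ := hπ j hj
      apply q2
      refine Finset.card_le_one.mp hC.le _ ?_ _ ?_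
      · exact Finset.mem_filter.mpr ⟨h2, (aux_idx_eq _ π hπ j _ hj q1).mpr (Or.inr rfl)⟩
      · exact Finset.mem_filter.mpr ⟨h1, rfl⟩
    constructor
    · intro j hjA
      have hj := Finset.mem_union_left B hjA
      obtain ⟨r1, r2⟩ := aux_idx_range _ π k hY hπ j hj
      rcases Finset.mem_union.mp (hπ j hj).1 with h' | h'
      · exact (main j hj A (h _ r1 r2).1 hjA h').elim
      · exact h'
    · intro j hjA
      have hj := Finset.mem_union_right A hjA
      obtain ⟨r1, r2⟩ := aux_idx_range _ π k hY hπ j hj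
      rcases Finset.mem_union.mp (hπ j hj).1 with h' | h'
      · exact h'
      · exact (main j hj B (h _ r1 r2).2 hjA h').elim
  · rintro ⟨hA, hB⟩ t ht1 ht2
    obtain ⟨j, hj, rfl⟩ := aux_idx_surj _ π k hY hπ t ht1 ht2
    have hs : ∀ C ⊆ A ∪ B, ∀ x ∈ C, ∀ y, y ∉ C → (x = j ∧ y = π j ∨ x = π j ∧ y = j) →
        (C.filter fun l => pairIdx (A ∪ B) π l = pairIdx (A ∪ B) π j).card = 1 := by
      intro C hC x hx y hy hxy
      rw [Finset.card_eq_one]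
      refine ⟨x, ?_⟩
      ext l
      simp only [Finset.mem_filter, Finset.mem_singleton]
      constructor
      · rintro ⟨hl, hl2⟩
        rw [aux_idx_eq _ π hπ j l hj (hC hl)] at hl2
        rcases hxy with ⟨e1, e2⟩ | ⟨e1, e2⟩ <;> rcases hl2 with e | e
        · rw [e, e1]
        · exact absurd (e2 ▸ e ▸ hl) hy
        · exact absurd (e2 ▸ e ▸ hl) hy
        · rw [e, e1]
      · rintro rfl
        refine ⟨hx, (aux_idx_eq _ π hπ j l hj (hC hx)).mpr ?_⟩
        rcases hxy with ⟨e1, e2⟩ | ⟨e1, e2⟩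
        · exact Or.inl e1
        · exact Or.inr e1
    rcases Finset.mem_union.mp hj with h | h
    · exact ⟨hs A Finset.subset_union_left j h (π j) (fun h' => hdis _ h' (hA j h)) (Or.inl ⟨rfl, rfl⟩),
        hs B Finset.subset_union_right (π j) (hA j h) j (fun h' => hdis _ h h') (Or.inr ⟨rfl, rfl⟩)⟩
    · exact ⟨hs A Finset.subset_union_left (π j) (hB j h) j (fun h' => hdis _ h' h) (Or.inr ⟨rfl, rfl⟩),
        hs B Finset.subset_union_right j h (π j) (fun h' => hdis _ (hB j h) h') (Or.inl ⟨rfl, rfl⟩)⟩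

theorem aux_lab_lt (d k x p v : ℕ) (hp : x = d → 1 ≤ p ∧ p ≤ k) (hd : 1 ≤ d) (hk : 1 ≤ k) (hv : v < d) :
    (if x = d then d - 1 + p else splitLabel d k x) = v ↔ x = v := by
  unfold splitLabel
  split_ifs with h1 h2
  · have := hp h1; omega
  · omega
  · omega

theorem aux_lab_n (d k x p n : ℕ) (hp : x = d → 1 ≤ p ∧ p ≤ k) (hd : 1 ≤ d) (hk : 1 ≤ k) (hv : d < n) :
    (if x = d then d - 1 + p else splitLabel d k x) = n + k - 1 ↔ x = n := by
  unfold splitLabel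
  split_ifs with h1 h2
  · have := hp h1; omega
  · omega
  · omega

theorem aux_lab_mid (d k x p t : ℕ) (hp : x = d → 1 ≤ p ∧ p ≤ k) (hd : 1 ≤ d) (hk : 1 ≤ k)
    (ht1 : 1 ≤ t) (ht2 : t ≤ k) :
    (if x = d then d - 1 + p else splitLabel d k x) = d - 1 + t ↔ x = d ∧ p = t := by
  unfold splitLabel
  split_ifs with h1 h2
  · have := hp h1; omega
  · omega
  · omega

theorem aux_lab_loop (d k x y p : ℕ) (hp : x = d ∨ y = d → 1 ≤ p ∧ p ≤ k) (hd : 1 ≤ d) (hk : 1 ≤ k)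
    (hxy : ¬ (x = d ∧ y = d)) :
    (if x = d then d - 1 + p else splitLabel d k x) = (if y = d then d - 1 + p else splitLabel d k y)
      ↔ x = y := by
  unfold splitLabel
  split_ifs with h1 h2 h3 h4 <;> first
   | omega
   | (have := hp (by omega); omega)

/-- (Lemma 4.3, vertex splitting) Suppose `1 ≤ d ≤ n−1`, `a_d ≥ 1`, no loops of
`G` are incident to `v_d`, and `deg_G(v_d) = 2 a_d`.  Then
`a_d! · M_{G,a}(S) = Σ_{π ∈ PM(Y_d)} M_{G[π],a'}(S)`, where `Y_d` is the set of
edges incident to `v_d`, `PM(Y_d)` is the set of perfect matchings of `Y_d`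
(encoded as fixed-point-free involutions of `Y_d`, extended by the identity),
`G[π]` is the `π`-split of `v_d` (with `n + a_d − 1` vertices, the pair `P_t`
reattached at the new vertex with label `d − 1 + t`), and
`a' = (a_1,…,a_{d−1},1,…,1) ∈ ℕ^{d+a_d−1}`. -/
theorem lem_4_3 (n : ℕ) (m : ℕ) (ga gb : Fin m → ℕ)
    (hga : ∀ j, 1 ≤ ga j ∧ ga j ≤ n) (hgb : ∀ j, 1 ≤ gb j ∧ gb j ≤ n)
    (d : ℕ) (hd1 : 1 ≤ d) (hd2 : d ≤ n - 1) (a : ℕ → ℕ) (ha : 1 ≤ a d)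
    (hnoloop : ∀ j, ¬(ga j = d ∧ gb j = d))
    (hdeg : degAt ga gb d = 2 * a d)
    (S : Finset (Fin m)) (hS : S ⊆ edgesAt ga gb n) :
    Nat.factorial (a d) * MballW n ga gb d a S =
      ∑ π ∈ Finset.univ.filter (fun π : Fin m → Fin m =>
          (∀ j ∈ edgesAt ga gb d, π j ∈ edgesAt ga gb d ∧ π j ≠ j ∧ π (π j) = j) ∧
          (∀ j, j ∉ edgesAt ga gb d → π j = j)),
        MballW (n + a d - 1)
          (fun j => if ga j = d then d - 1 + pairIdx (edgesAt ga gb d) π j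
                    else splitLabel d (a d) (ga j))
          (fun j => if gb j = d then d - 1 + pairIdx (edgesAt ga gb d) π j
                    else splitLabel d (a d) (gb j))
          (d + a d - 1)
          (fun i => if i < d then a i else 1) S := by
  have hdn : d < n := by omega
  set Y := edgesAt ga gb d with hYdef
  have hYc : Y.card = 2 * a d := by
    rw [← hdeg, hYdef]
    unfold edgesAt degAt
    rw [Finset.filter_or, Finset.card_union_of_disjoint]
    rw [Finset.disjoint_filter]
    intro j _ h1 h2
    exact hnoloop j ⟨h1, h2⟩
  have hU : ∀ O : Fin m → Bool, outAt ga gb O d ∪ inAt ga gb O d = Y := by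
    intro O
    ext j
    simp only [hYdef, outAt, inAt, edgesAt, Finset.mem_union, Finset.mem_filter, Finset.mem_univ, true_and]
    cases O j <;> simp <;> tauto
  have hD : ∀ O : Fin m → Bool, Disjoint (outAt ga gb O d) (inAt ga gb O d) := by
    intro O
    unfold outAt inAt
    rw [Finset.disjoint_filter]
    intro j _ h1 h2
    have := hnoloop j
    cases h : O j <;> simp [h] at h1 h2 <;> tauto
  -- the base condition
  let Q : (Fin m → Bool) → Prop := fun O =>
    (∀ j, ga j = gb j → O j = false) ∧
    (∀ i : ℕ, 1 ≤ i → i < d → (outAt ga gb O i).card = a i ∧ (inAt ga gb O i).card = a i) ∧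
    outAt ga gb O n = S ∧ inAt ga gb O n = edgesAt ga gb n \ S
  have hL : MballW n ga gb d a S = (Finset.univ.filter fun O : Fin m → Bool =>
      Q O ∧ (outAt ga gb O d).card = a d ∧ (inAt ga gb O d).card = a d).card := by
    unfold MballW
    congr 1
    ext O
    simp only [Finset.mem_filter, Finset.mem_univ, true_and, Q]
    constructor
    · rintro ⟨h1, h2, h3, h4⟩
      exact ⟨⟨h1, fun i hi hi' => h2 i hi hi'.le, h3, h4⟩, h2 d hd1 le_rfl⟩
    · rintro ⟨⟨h1, h2, h3, h4⟩, h5⟩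
      refine ⟨h1, fun i hi hi' => ?_, h3, h4⟩
      rcases Nat.lt_or_eq_of_le hi' with h | h
      · exact h2 i hi h
      · rw [h]; exact h5
  have hR : ∀ π ∈ Finset.univ.filter (fun π : Fin m → Fin m =>
          (∀ j ∈ Y, π j ∈ Y ∧ π j ≠ j ∧ π (π j) = j) ∧ (∀ j, j ∉ Y → π j = j)),
      MballW (n + a d - 1)
          (fun j => if ga j = d then d - 1 + pairIdx Y π j else splitLabel d (a d) (ga j))
          (fun j => if gb j = d then d - 1 + pairIdx Y π j else splitLabel d (a d) (gb j))
          (d + a d - 1) (fun i => if i < d then a i else 1) S =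
      (Finset.univ.filter fun O : Fin m → Bool => Q O ∧
        (∀ j ∈ outAt ga gb O d, π j ∈ inAt ga gb O d) ∧
        (∀ j ∈ inAt ga gb O d, π j ∈ outAt ga gb O d)).card := by
    intro π hπ
    simp only [Finset.mem_filter, Finset.mem_univ, true_and] at hπ
    have hp : ∀ j, ga j = d ∨ gb j = d → 1 ≤ pairIdx Y π j ∧ pairIdx Y π j ≤ a d := by
      intro j hj
      exact aux_idx_range Y π (a d) hYc hπ.1 j (by simp [hYdef, edgesAt, hj])
    have hpa : ∀ j, ga j = d → 1 ≤ pairIdx Y π j ∧ pairIdx Y π j ≤ a d := fun j h => hp j (Or.inl h)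
    have hpb : ∀ j, gb j = d → 1 ≤ pairIdx Y π j ∧ pairIdx Y π j ≤ a d := fun j h => hp j (Or.inr h)
    set ga' : Fin m → ℕ := fun j => if ga j = d then d - 1 + pairIdx Y π j else splitLabel d (a d) (ga j) with hga'
    set gb' : Fin m → ℕ := fun j => if gb j = d then d - 1 + pairIdx Y π j else splitLabel d (a d) (gb j) with hgb'
    have la : ∀ j v, v < d → (ga' j = v ↔ ga j = v) := fun j v hv => aux_lab_lt d (a d) _ _ v (hpa j) hd1 ha hv
    have lb : ∀ j v, v < d → (gb' j = v ↔ gb j = v) := fun j v hv => aux_lab_lt d (a d) _ _ v (hpb j) hd1 ha hv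
    have na : ∀ j, (ga' j = n + a d - 1 ↔ ga j = n) := fun j => aux_lab_n d (a d) _ _ n (hpa j) hd1 ha hdn
    have nb : ∀ j, (gb' j = n + a d - 1 ↔ gb j = n) := fun j => aux_lab_n d (a d) _ _ n (hpb j) hd1 ha hdn
    have ma : ∀ j t, 1 ≤ t → t ≤ a d → (ga' j = d - 1 + t ↔ ga j = d ∧ pairIdx Y π j = t) :=
      fun j t h1 h2 => aux_lab_mid d (a d) _ _ t (hpa j) hd1 ha h1 h2
    have mb : ∀ j t, 1 ≤ t → t ≤ a d → (gb' j = d - 1 + t ↔ gb j = d ∧ pairIdx Y π j = t) :=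
      fun j t h1 h2 => aux_lab_mid d (a d) _ _ t (hpb j) hd1 ha h1 h2
    have lo : ∀ j, (ga' j = gb' j ↔ ga j = gb j) := fun j =>
      aux_lab_loop d (a d) _ _ _ (hp j) hd1 ha (hnoloop j)
    have outlt : ∀ O v, v < d → outAt ga' gb' O v = outAt ga gb O v := by
      intro O v hv; simp only [outAt, la _ v hv, lb _ v hv]
    have inlt : ∀ O v, v < d → inAt ga' gb' O v = inAt ga gb O v := by
      intro O v hv; simp only [inAt, la _ v hv, lb _ v hv]
    have outn : ∀ O, outAt ga' gb' O (n + a d - 1) = outAt ga gb O n := by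
      intro O; simp only [outAt, na, nb]
    have inn : ∀ O, inAt ga' gb' O (n + a d - 1) = inAt ga gb O n := by
      intro O; simp only [inAt, na, nb]
    have edn : edgesAt ga' gb' (n + a d - 1) = edgesAt ga gb n := by
      simp only [edgesAt, na, nb]
    have outm : ∀ O t, 1 ≤ t → t ≤ a d → outAt ga' gb' O (d - 1 + t) =
        (outAt ga gb O d).filter fun j => pairIdx Y π j = t := by
      intro O t h1 h2
      ext j
      simp only [outAt, ma _ t h1 h2, mb _ t h1 h2, Finset.mem_filter, Finset.mem_univ, true_and]
      tauto
    have inm : ∀ O t, 1 ≤ t → t ≤ a d → inAt ga' gb' O (d - 1 + t) =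
        (inAt ga gb O d).filter fun j => pairIdx Y π j = t := by
      intro O t h1 h2
      ext j
      simp only [inAt, ma _ t h1 h2, mb _ t h1 h2, Finset.mem_filter, Finset.mem_univ, true_and]
      tauto
    unfold MballW
    congr 1
    ext O
    simp only [Finset.mem_filter, Finset.mem_univ, true_and]
    have hsw := aux_swap (outAt ga gb O d) (inAt ga gb O d) (hD O) π (a d)
      (by rw [hU]; exact hYc) (by rw [hU]; exact hπ.1)
    rw [hU] at hsw
    rw [← hsw]
    simp only [Q, lo, outn, inn, edn]
    constructor
    · rintro ⟨h1, h2, h3, h4⟩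
      refine ⟨⟨h1, ?_, h3, h4⟩, ?_⟩
      · intro i hi hi'
        have := h2 i hi (by omega)
        rw [outlt O i hi', inlt O i hi'] at this
        simpa [hi'] using this
      · intro t ht1 ht2
        have := h2 (d - 1 + t) (by omega) (by omega)
        rw [outm O t ht1 ht2, inm O t ht1 ht2, if_neg (by omega)] at this
        exact this
    · rintro ⟨⟨h1, h2, h3, h4⟩, h5⟩
      refine ⟨h1, ?_, h3, h4⟩
      intro i hi hi'
      by_cases hid : i < d
      · rw [outlt O i hid, inlt O i hid, if_pos hid]
        exact h2 i hi hid
      · obtain ⟨t, rfl⟩ : ∃ t, i = d - 1 + t := ⟨i - (d - 1), by omega⟩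
        rw [outm O t (by omega) (by omega), inm O t (by omega) (by omega), if_neg hid]
        exact h5 t (by omega) (by omega)
  rw [Finset.sum_congr rfl hR, hL]
  simp only [Finset.card_filter (p := fun O : Fin m → Bool => _) (s := Finset.univ)]
  rw [Finset.sum_comm, Finset.mul_sum]
  refine Finset.sum_congr rfl fun O _ => ?_
  rw [← Finset.card_filter, Finset.filter_filter]
  by_cases hQ : Q O
  · by_cases hc : (outAt ga gb O d).card = a d ∧ (inAt ga gb O d).card = a d
    · rw [if_pos ⟨hQ, hc⟩, mul_one, ← aux_count _ _ (hD O) (a d) hc.1 hc.2, hU]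
      congr 1
      ext π
      simp only [Finset.mem_filter, Finset.mem_univ, true_and, hQ]
    · rw [if_neg (fun h => hc h.2), mul_zero]
      symm
      rw [Finset.card_eq_zero, Finset.filter_eq_empty_iff]
      rintro π - ⟨⟨h1, h2⟩, -, h3, h4⟩
      apply hc
      have hcard : (outAt ga gb O d).card = (inAt ga gb O d).card := by
        refine Finset.card_bij' (fun e _ => π e) (fun e _ => π e) h3 h4 ?_ ?_
        · intro e he; exact (h1 e (by rw [← hU O]; exact Finset.mem_union_left _ he)).2.2
        · intro e he; exact (h1 e (by rw [← hU O]; exact Finset.mem_union_right _ he)).2.2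
      have := Finset.card_union_of_disjoint (hD O)
      rw [hU, hYc] at this
      omega
  · rw [if_neg (fun h => hQ h.1), mul_zero]
    symm
    rw [Finset.card_eq_zero, Finset.filter_eq_empty_iff]
    rintro π - ⟨-, h, -⟩
    exact hQ h
end

section
/- (Lemma 4.4, type 1 recurrence) Let 1 ≤ d ≤ n−1 and a = (a_1,…,a_d) ∈ ℕ^d with a_d = 1. Suppose v_d is incident to exactly two edges, namely the non-loop edges e_{m−1} and e_m, whose endpoints other than v_d are v_r and v_s respectively, with r ≠ s, r ≠ d, s ≠ d, and s ≠ n. Then M_{G,a}(S) = M_{G/e_m, a'}(S) for every S ⊆ X, where a' = (a_1,…,a_{d−1}) ∈ ℕ^{d−1}. (Since s ≠ n and d ≠ n, the last vertex of G/e_m is v_n and the set X is the same for G and G/e_m.) -/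
open Finset
open scoped Classical

/-- Relabel a set of edge indices of `G` as edge indices of `G − e_m`
(only meaningful when no element is the last index). -/
noncomputable def castdown {m : ℕ} (S : Finset (Fin (m+1))) : Finset (Fin m) :=
  S.preimage Fin.castSucc (Fin.castSucc_injective m).injOn

/-- Vertex relabeling for the contraction `G/e` of an edge joining `v_i` and `v_j`
(`i < j`): `v_j` is merged into `v_i`, labels above `j` shift down by one. -/
def contractLabel (i j k : ℕ) : ℕ := if k = j then i else if j < k then k - 1 else k

lemma cl_eq (d s k l : ℕ) (hd1 : 1 ≤ d) (hs : 1 ≤ s) (hsd : s ≠ d) (hk : 1 ≤ k) (hl : 1 ≤ l)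
    (hkd : k ≠ d) (hld : l ≠ d) :
    contractLabel (min d s) (max d s) k = contractLabel (min d s) (max d s) l ↔ k = l := by
  unfold contractLabel
  rcases lt_or_gt_of_ne hsd with h | h
  · rw [min_eq_right h.le, max_eq_left h.le]; split_ifs <;> omega
  · rw [min_eq_left h.le, max_eq_right h.le]; split_ifs <;> omega

lemma cl_ds (d s : ℕ) (hsd : s ≠ d) :
    contractLabel (min d s) (max d s) d = contractLabel (min d s) (max d s) s := by
  unfold contractLabel
  rcases lt_or_gt_of_ne hsd with h | h
  · rw [min_eq_right h.le, max_eq_left h.le]; split_ifs <;> omega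
  · rw [min_eq_left h.le, max_eq_right h.le]; split_ifs <;> omega

lemma cl_lt (d s i : ℕ) (hsd : s ≠ d) (hi : i < d) :
    contractLabel (min d s) (max d s) i = i := by
  unfold contractLabel
  rcases lt_or_gt_of_ne hsd with h | h
  · rw [min_eq_right h.le, max_eq_left h.le]; split_ifs <;> omega
  · rw [min_eq_left h.le, max_eq_right h.le]; split_ifs <;> omega

lemma cl_n (d s n : ℕ) (hd : d < n) (hs : s < n) :
    contractLabel (min d s) (max d s) n = n - 1 := by
  unfold contractLabel
  have : max d s < n := max_lt hd hs
  split_ifs <;> omega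

/-- exactly one of `e_{m-1}`, `e_m` goes out of `d`. -/
def balD {m : ℕ} (ga : Fin (m+2) → ℕ) (d : ℕ) (O : Fin (m+2) → Bool) : Prop :=
  (O ((Fin.last m).castSucc) = true ↔ ga ((Fin.last m).castSucc) = d) ↔
    ¬ (O (Fin.last (m+1)) = true ↔ ga (Fin.last (m+1)) = d)

lemma card_out_key (m : ℕ) (ga gb : Fin (m+2) → ℕ) (d r s : ℕ) (c : ℕ → ℕ)
    (h1 : (ga ((Fin.last m).castSucc) = d ∧ gb ((Fin.last m).castSucc) = r) ∨
          (ga ((Fin.last m).castSucc) = r ∧ gb ((Fin.last m).castSucc) = d))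
    (h2 : (ga (Fin.last (m+1)) = d ∧ gb (Fin.last (m+1)) = s) ∨
          (ga (Fin.last (m+1)) = s ∧ gb (Fin.last (m+1)) = d))
    (hrs : r ≠ s) (hrd : r ≠ d) (hsd : s ≠ d)
    (hnd : ∀ j : Fin m, ga j.castSucc.castSucc ≠ d ∧ gb j.castSucc.castSucc ≠ d)
    (i : ℕ) (hid : i ≠ d)
    (hca : ∀ j, ga j ≠ d → (c (ga j) = c i ↔ ga j = i))
    (hcb : ∀ j, gb j ≠ d → (c (gb j) = c i ↔ gb j = i))
    (hds : c d = c s) (O : Fin (m+2) → Bool) (hO : balD ga d O) :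
    (outAt ga gb O i).card =
    (outAt (fun j : Fin (m+1) => c (ga j.castSucc)) (fun j : Fin (m+1) => c (gb j.castSucc))
      (fun j => O j.castSucc) (c i)).card := by
  unfold outAt
  rw [Finset.card_filter, Finset.card_filter, Fin.sum_univ_castSucc, Fin.sum_univ_castSucc,
    Fin.sum_univ_castSucc, add_assoc]
  congr 1
  · refine Finset.sum_congr rfl fun j _ => ?_
    simp only [hca _ (hnd j).1, hcb _ (hnd j).2]
  · have a1 := hca ((Fin.last m).castSucc)
    have a2 := hca (Fin.last (m+1))
    have b1 := hcb ((Fin.last m).castSucc)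
    have b2 := hcb (Fin.last (m+1))
    unfold balD at hO
    cases hp : O ((Fin.last m).castSucc) <;> cases hq : O (Fin.last (m+1)) <;>
    rcases h1 with ⟨h, h'⟩ | ⟨h, h'⟩ <;> rcases h2 with ⟨k, k'⟩ | ⟨k, k'⟩ <;>
    simp only [hp, hq, h, h', k, k'] at hO a1 a2 b1 b2 ⊢ <;> grind

lemma out_set_key (m : ℕ) (ga gb : Fin (m+2) → ℕ) (d r s : ℕ) (c : ℕ → ℕ)
    (h1 : (ga ((Fin.last m).castSucc) = d ∧ gb ((Fin.last m).castSucc) = r) ∨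
          (ga ((Fin.last m).castSucc) = r ∧ gb ((Fin.last m).castSucc) = d))
    (h2 : (ga (Fin.last (m+1)) = d ∧ gb (Fin.last (m+1)) = s) ∨
          (ga (Fin.last (m+1)) = s ∧ gb (Fin.last (m+1)) = d))
    (n : ℕ) (hnd : n ≠ d) (hns : n ≠ s) 
    (hca : ∀ j, (c (ga j) = c n ↔ ga j = n))
    (hcb : ∀ j, (c (gb j) = c n ↔ gb j = n))
    (O : Fin (m+2) → Bool) (T : Finset (Fin (m+2))) (hT : Fin.last (m+1) ∉ T) :
    outAt ga gb O n = T ↔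
    outAt (fun j : Fin (m+1) => c (ga j.castSucc)) (fun j : Fin (m+1) => c (gb j.castSucc))
      (fun j => O j.castSucc) (c n) = castdown T := by
  simp only [Finset.ext_iff, outAt, castdown, Finset.mem_filter, Finset.mem_univ, true_and,
    Finset.mem_preimage, hca, hcb]
  rw [Fin.forall_fin_succ']
  constructor
  · exact fun h => h.1
  · refine fun h => ⟨h, ?_⟩
    grind

lemma balD_of_card (m : ℕ) (ga gb : Fin (m+2) → ℕ) (d r s : ℕ)
    (h1 : (ga ((Fin.last m).castSucc) = d ∧ gb ((Fin.last m).castSucc) = r) ∨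
          (ga ((Fin.last m).castSucc) = r ∧ gb ((Fin.last m).castSucc) = d))
    (h2 : (ga (Fin.last (m+1)) = d ∧ gb (Fin.last (m+1)) = s) ∨
          (ga (Fin.last (m+1)) = s ∧ gb (Fin.last (m+1)) = d))
    (hrd : r ≠ d) (hsd : s ≠ d)
    (hnd : ∀ j : Fin m, ga j.castSucc.castSucc ≠ d ∧ gb j.castSucc.castSucc ≠ d)
    (O : Fin (m+2) → Bool) :
    (outAt ga gb O d).card = 1 ↔ balD ga d O := by
  unfold outAt
  rw [Finset.card_filter, Fin.sum_univ_castSucc, Fin.sum_univ_castSucc, add_assoc]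
  rw [Finset.sum_eq_zero (fun j _ => by simp [(hnd j).1, (hnd j).2]), zero_add]
  unfold balD
  cases hp : O ((Fin.last m).castSucc) <;> cases hq : O (Fin.last (m+1)) <;>
    rcases h1 with ⟨h, h'⟩ | ⟨h, h'⟩ <;> rcases h2 with ⟨k, k'⟩ | ⟨k, k'⟩ <;>
    simp [hp, hq, h, h', k, k', hrd, hsd]

lemma balD_swap (m : ℕ) (ga gb : Fin (m+2) → ℕ) (d r s : ℕ)
    (h1 : (ga ((Fin.last m).castSucc) = d ∧ gb ((Fin.last m).castSucc) = r) ∨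
          (ga ((Fin.last m).castSucc) = r ∧ gb ((Fin.last m).castSucc) = d))
    (h2 : (ga (Fin.last (m+1)) = d ∧ gb (Fin.last (m+1)) = s) ∨
          (ga (Fin.last (m+1)) = s ∧ gb (Fin.last (m+1)) = d))
    (hrd : r ≠ d) (hsd : s ≠ d)
    (O : Fin (m+2) → Bool) : balD ga d O ↔ balD gb d O := by
  unfold balD
  rcases h1 with ⟨h, h'⟩ | ⟨h, h'⟩ <;> rcases h2 with ⟨k, k'⟩ | ⟨k, k'⟩ <;>
    simp [h, h', k, k', hrd, hsd]

lemma prop_aux1 {A B C D : Prop} (h : A ↔ ¬ (B ↔ C)) (h' : A ↔ ¬ (D ↔ C)) : B ↔ D := by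
  tauto

lemma prop_aux2 {A B : Prop} : A ↔ ¬ ((¬ (A ↔ B)) ↔ B) := by
  tauto

/-- (Lemma 4.4, type 1 recurrence) Suppose `1 ≤ d ≤ n−1`, `a_d = 1`, and `v_d`
is incident to exactly the two non-loop edges `e_{m−1}` and `e_m` (the last two
edges, indices `(Fin.last m).castSucc` and `Fin.last (m+1)` of `Fin (m+2)`),
whose other endpoints are `v_r` and `v_s` respectively, with `r ≠ s`, `r ≠ d`,
`s ≠ d`, `s ≠ n`.  Then `M_{G,a}(S) = M_{G/e_m,a'}(S)` where
`a' = (a_1,…,a_{d−1})`. -/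
theorem lem_4_4 (n : ℕ) (m : ℕ) (ga gb : Fin (m+2) → ℕ)
    (hga : ∀ j, 1 ≤ ga j ∧ ga j ≤ n) (hgb : ∀ j, 1 ≤ gb j ∧ gb j ≤ n)
    (d : ℕ) (hd1 : 1 ≤ d) (hd2 : d ≤ n - 1) (a : ℕ → ℕ) (had : a d = 1)
    (r s : ℕ)
    (h1 : (ga ((Fin.last m).castSucc) = d ∧ gb ((Fin.last m).castSucc) = r) ∨
          (ga ((Fin.last m).castSucc) = r ∧ gb ((Fin.last m).castSucc) = d))
    (h2 : (ga (Fin.last (m+1)) = d ∧ gb (Fin.last (m+1)) = s) ∨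
          (ga (Fin.last (m+1)) = s ∧ gb (Fin.last (m+1)) = d))
    (hrs : r ≠ s) (hrd : r ≠ d) (hsd : s ≠ d) (hsn : s ≠ n)
    (hinc : edgesAt ga gb d = {(Fin.last m).castSucc, Fin.last (m+1)})
    (S : Finset (Fin (m+2))) (hS : S ⊆ edgesAt ga gb n) :
    MballW n ga gb d a S =
      MballW (n - 1)
        (fun j : Fin (m+1) => contractLabel (min d s) (max d s) (ga j.castSucc))
        (fun j : Fin (m+1) => contractLabel (min d s) (max d s) (gb j.castSucc))
        (d - 1) a (castdown S) := by
  have hs1 : 1 ≤ s := by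
    rcases h2 with h | h
    · exact h.2 ▸ (hgb _).1
    · exact h.1 ▸ (hga _).1
  have hsn' : s < n := by
    refine lt_of_le_of_ne ?_ hsn
    rcases h2 with h | h
    · exact h.2 ▸ (hgb _).2
    · exact h.1 ▸ (hga _).2
  have hdn : d < n := by omega
  have hnd : ∀ j : Fin m, ga j.castSucc.castSucc ≠ d ∧ gb j.castSucc.castSucc ≠ d := by
    intro j
    have hj : j.castSucc.castSucc ∉ edgesAt ga gb d := by
      rw [hinc]
      simp [Fin.ext_iff]
      omega
    simpa [edgesAt] using hj
  have h1' : (gb ((Fin.last m).castSucc) = d ∧ ga ((Fin.last m).castSucc) = r) ∨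
      (gb ((Fin.last m).castSucc) = r ∧ ga ((Fin.last m).castSucc) = d) := by tauto
  have h2' : (gb (Fin.last (m+1)) = d ∧ ga (Fin.last (m+1)) = s) ∨
      (gb (Fin.last (m+1)) = s ∧ ga (Fin.last (m+1)) = d) := by tauto
  have hnd' : ∀ j : Fin m, gb j.castSucc.castSucc ≠ d ∧ ga j.castSucc.castSucc ≠ d :=
    fun j => (hnd j).symm
  have hclt : ∀ i, i < d → contractLabel (min d s) (max d s) i = i :=
    fun i hi => cl_lt d s i hsd hi
  have hcn := cl_n d s n hdn hsn'
  have hds := cl_ds d s hsd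
  have hce : ∀ k l, 1 ≤ k → 1 ≤ l → k ≠ d → l ≠ d →
      (contractLabel (min d s) (max d s) k = contractLabel (min d s) (max d s) l ↔ k = l) :=
    fun k l hk hl hkd hld => cl_eq d s k l hd1 hs1 hsd hk hl hkd hld
  generalize hcdef : contractLabel (min d s) (max d s) = c at *
  have hcN : ∀ k, 1 ≤ k → (c k = c n ↔ k = n) := by
    intro k hk
    by_cases hkd : k = d
    · subst hkd
      rw [hds, hce s n hs1 (by omega) hsd (by omega)]
      omega
    · exact hce k n hk (by omega) hkd (by omega)
  have hqX : Fin.last (m+1) ∉ edgesAt ga gb n := by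
    simp only [edgesAt, Finset.mem_filter, Finset.mem_univ, true_and]
    omega
  have hqS : Fin.last (m+1) ∉ S := fun h => hqX (hS h)
  have hX : edgesAt (fun j : Fin (m+1) => c (ga j.castSucc))
      (fun j : Fin (m+1) => c (gb j.castSucc)) (c n) \ castdown S
      = castdown (edgesAt ga gb n \ S) := by
    ext j
    simp [edgesAt, castdown, hcN _ (hga _).1, hcN _ (hgb _).1]
  have hloop : ∀ O : Fin (m+2) → Bool, (∀ j, ga j = gb j → O j = false) ↔
      (∀ j : Fin (m+1), c (ga j.castSucc) = c (gb j.castSucc) → O j.castSucc = false) := by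
    intro O
    rw [Fin.forall_fin_succ', Fin.forall_fin_succ',
      Fin.forall_fin_succ' (P := fun j : Fin (m+1) =>
        c (ga j.castSucc) = c (gb j.castSucc) → O j.castSucc = false)]
    have e1 : ga (Fin.last (m+1)) ≠ gb (Fin.last (m+1)) := by omega
    have e2 : ga ((Fin.last m).castSucc) ≠ gb ((Fin.last m).castSucc) := by omega
    have hr1 : 1 ≤ r := by
      have := (hga (Fin.last m).castSucc).1
      have := (hgb (Fin.last m).castSucc).1
      omega
    have e3 : c (ga ((Fin.last m).castSucc)) ≠ c (gb ((Fin.last m).castSucc)) := by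
      have hx := (hce r s hr1 hs1 hrd hsd).not.2 hrs
      rcases h1 with ⟨h, h'⟩ | ⟨h, h'⟩ <;> rw [h, h', hds]
      · exact fun h => hx h.symm
      · exact hx
    have e4 : ∀ j : Fin m, c (ga j.castSucc.castSucc) = c (gb j.castSucc.castSucc) ↔
        ga j.castSucc.castSucc = gb j.castSucc.castSucc := fun j =>
      hce _ _ (hga _).1 (hgb _).1 (hnd j).1 (hnd j).2
    simp [e1, e2, e3, e4]
  have key : ∀ O : Fin (m+2) → Bool,
      ((∀ j, ga j = gb j → O j = false) ∧
      (∀ i : ℕ, 1 ≤ i → i ≤ d → (outAt ga gb O i).card = a i ∧ (inAt ga gb O i).card = a i) ∧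
      outAt ga gb O n = S ∧ inAt ga gb O n = edgesAt ga gb n \ S) ↔
      (balD ga d O ∧ 
      (∀ j : Fin (m+1), c (ga j.castSucc) = c (gb j.castSucc) → O j.castSucc = false) ∧
      (∀ i : ℕ, 1 ≤ i → i ≤ d - 1 →
        (outAt (fun j : Fin (m+1) => c (ga j.castSucc)) (fun j : Fin (m+1) => c (gb j.castSucc))
          (fun j => O j.castSucc) i).card = a i ∧
        (inAt (fun j : Fin (m+1) => c (ga j.castSucc)) (fun j : Fin (m+1) => c (gb j.castSucc))
          (fun j => O j.castSucc) i).card = a i) ∧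
      outAt (fun j : Fin (m+1) => c (ga j.castSucc)) (fun j : Fin (m+1) => c (gb j.castSucc))
          (fun j => O j.castSucc) (n-1) = castdown S ∧
      inAt (fun j : Fin (m+1) => c (ga j.castSucc)) (fun j : Fin (m+1) => c (gb j.castSucc))
          (fun j => O j.castSucc) (n-1) =
        edgesAt (fun j : Fin (m+1) => c (ga j.castSucc)) (fun j : Fin (m+1) => c (gb j.castSucc))
          (n-1) \ castdown S) := by
    intro O
    have hsw := balD_swap m ga gb d r s h1 h2 hrd hsd O
    have k1 := out_set_key m ga gb d r s c h1 h2 n (by omega) (by omega)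
      (fun j => hcN _ (hga j).1) (fun j => hcN _ (hgb j).1) O S hqS
    have k2 : inAt ga gb O n = edgesAt ga gb n \ S ↔ _ :=
      out_set_key m gb ga d r s c h1' h2' n (by omega) (by omega)
      (fun j => hcN _ (hgb j).1) (fun j => hcN _ (hga j).1) O (edgesAt ga gb n \ S)
      (fun h => hqX (Finset.mem_sdiff.1 h).1)
    rw [← hX] at k2
    rw [hcn] at k1 k2
    have b1 := balD_of_card m ga gb d r s h1 h2 hrd hsd hnd O
    have b2 : (inAt ga gb O d).card = 1 ↔ _ :=
      balD_of_card m gb ga d r s h1' h2' hrd hsd hnd' O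
    have c1 : balD ga d O → ∀ i, 1 ≤ i → i < d → _ := fun hb i hi hid =>
      card_out_key m ga gb d r s c h1 h2 hrs hrd hsd hnd i hid.ne
      (fun j hj => hce _ _ (hga j).1 hi hj hid.ne) (fun j hj => hce _ _ (hgb j).1 hi hj hid.ne)
      hds O hb
    have c2 : balD ga d O → ∀ i, 1 ≤ i → i < d → (inAt ga gb O i).card = _ := fun hb i hi hid =>
      card_out_key m gb ga d r s c h1' h2' hrs hrd hsd hnd' i hid.ne
      (fun j hj => hce _ _ (hgb j).1 hi hj hid.ne) (fun j hj => hce _ _ (hga j).1 hi hj hid.ne)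
      hds O (hsw.1 hb)
    rw [hloop O]
    constructor
    · rintro ⟨p1, p2, p3, p4⟩
      have hb : balD ga d O := b1.1 (by rw [(p2 d hd1 le_rfl).1, had])
      refine ⟨hb, p1, fun i hi hid => ?_, k1.1 p3, k2.1 p4⟩
      have hid' : i < d := by omega
      have u1 := c1 hb i hi hid'
      have u2 := c2 hb i hi hid'
      rw [hclt i hid'] at u1 u2
      have u := p2 i hi hid'.le
      exact ⟨u1 ▸ u.1, u2.symm.trans u.2⟩
    · rintro ⟨hb, p1, p2, p3, p4⟩
      refine ⟨p1, fun i hi hid => ?_, k1.2 p3, k2.2 p4⟩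
      rcases eq_or_lt_of_le hid with rfl | hid'
      · rw [had]; exact ⟨b1.2 hb, b2.2 (hsw.1 hb)⟩
      have u1 := c1 hb i hi hid'
      have u2 := c2 hb i hi hid'
      rw [hclt i hid'] at u1 u2
      have u := p2 i hi (by omega)
      exact ⟨u1.trans u.1, u2.trans u.2⟩
  unfold MballW
  refine Finset.card_bij (fun O _ => fun j => O j.castSucc) ?_ ?_ ?_
  · intro O hO
    rw [Finset.mem_filter] at hO ⊢
    exact ⟨Finset.mem_univ _, ((key O).1 hO.2).2⟩
  · intro O hO O' hO' he
    rw [Finset.mem_filter] at hO hO'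
    have x1 := ((key O).1 hO.2).1
    have x2 := ((key O').1 hO'.2).1
    have he' : ∀ j : Fin (m+1), O j.castSucc = O' j.castSucc := fun j => congrFun he j
    funext j
    refine Fin.lastCases ?_ he' j
    unfold balD at x1 x2
    rw [he'] at x1
    rw [Bool.eq_iff_iff]
    exact prop_aux1 x1 x2
  · intro O' hO'
    rw [Finset.mem_filter] at hO'
    let O : Fin (m+2) → Bool := Fin.snoc (α := fun _ => Bool) O'
      (decide (¬ ((O' (Fin.last m) = true ↔ ga ((Fin.last m).castSucc) = d) ↔
        ga (Fin.last (m+1)) = d)))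
    have hOc : (fun j : Fin (m+1) => O j.castSucc) = O' := by
      funext j; simp [O]
    have hb : balD ga d O := by
      unfold balD
      simp only [O, Fin.snoc_castSucc, Fin.snoc_last, decide_eq_true_eq]
      exact prop_aux2
    refine ⟨O, ?_, hOc⟩
    rw [Finset.mem_filter]
    refine ⟨Finset.mem_univ _, (key O).2 ⟨hb, ?_⟩⟩
    have hOc' : ∀ j : Fin (m+1), O j.castSucc = O' j := fun j => congrFun hOc j
    rw [hOc]
    simp only [hOc']
    exact hO'.2
end

section
/- (Lemma 4.5, type 2 and type 3 recurrences) Let a = (a_1,…,a_d) ∈ ℕ^d with a_d = 1, and suppose v_d is incident to exactly two edges, namely e_{m−1} and e_m. (Type 2) If 2 ≤ d ≤ n−1, a_{d−1} ≥ 1, and both e_{m−1} and e_m join v_d and v_{d−1}, then M_{G,a}(S) = 2 · M_{G−e_{m−1}−e_m, a'}(S) for every S ⊆ X, where a' = (a_1,…,a_{d−2}, a_{d−1} − 1) ∈ ℕ^{d−1}. (Type 3) If 1 ≤ d < n−1 and both e_{m−1} and e_m join v_d and v_{d+1}, then M_{G,a}(S) = 2 · M_{G−e_{m−1}−e_m,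 a''}(S) for every S ⊆ X, where a'' = (a_1,…,a_{d−1}) ∈ ℕ^{d−1}. (In both cases neither deleted edge is incident to v_n, so X is the same for G and G − e_{m−1} − e_m.) -/
open Finset
open scoped Classical

/-- Relabel a set of edge indices of `G` as edge indices of `G − e_{m-1} − e_m`. -/
noncomputable def castdown2 {m : ℕ} (S : Finset (Fin (m+2))) : Finset (Fin m) :=
  S.preimage (fun j : Fin m => j.castSucc.castSucc)
    (((Fin.castSucc_injective (m+1)).comp (Fin.castSucc_injective m)).injOn)

lemma aux_card {m : ℕ} (P : (Fin (m+2) → Bool) → Prop) (Q : (Fin m → Bool) → Prop)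
    [DecidablePred P] [DecidablePred Q] (c : Bool)
    (h : ∀ O' x y, P (Fin.snoc (α := fun _ => Bool) (Fin.snoc (α := fun _ => Bool) O' x) y) ↔
      (y = (x ^^ c) ∧ Q O')) :
    (Finset.univ.filter P).card = 2 * (Finset.univ.filter Q).card := by
  have : 2 * (Finset.univ.filter Q).card =
      ((Finset.univ : Finset Bool) ×ˢ (Finset.univ.filter Q)).card := by
    rw [Finset.card_product]; simp
  rw [this]
  symm
  refine Finset.card_bij (fun p _ => (Fin.snoc (α := fun _ => Bool)
    (Fin.snoc (α := fun _ => Bool) p.2 p.1) (p.1 ^^ c) : Fin (m+2) → Bool)) ?_ ?_ ?_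
  · rintro ⟨x, O'⟩ hp
    simp only [Finset.mem_product, Finset.mem_filter, Finset.mem_univ, true_and] at hp ⊢
    rw [h]
    exact ⟨rfl, hp⟩
  · rintro ⟨x, O'⟩ hp ⟨x', O''⟩ hp' heq
    have h1 := (Fin.snoc_injective2 heq).1
    have h2 := Fin.snoc_injective2 h1
    exact Prod.ext h2.2 h2.1
  · intro O hO
    simp only [Finset.mem_filter, Finset.mem_univ, true_and] at hO
    have e : O = Fin.snoc (α := fun _ => Bool) (Fin.snoc (α := fun _ => Bool)
      (Fin.init (α := fun _ => Bool) (Fin.init (α := fun _ => Bool) O))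
      (Fin.init (α := fun _ => Bool) O (Fin.last m))) (O (Fin.last (m+1))) := by
      rw [Fin.snoc_init_self, Fin.snoc_init_self]
    rw [e, h] at hO
    refine ⟨(Fin.init (α := fun _ => Bool) O (Fin.last m),
      Fin.init (α := fun _ => Bool) (Fin.init (α := fun _ => Bool) O)), ?_, ?_⟩
    · simpa using hO.2
    · simp only
      rw [← hO.1]
      exact e.symm

lemma aux_filter {m : ℕ} (p : Fin (m+2) → Prop) [DecidablePred p] :
    (Finset.univ.filter p).card = (Finset.univ.filter fun j : Fin m => p j.castSucc.castSucc).card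
      + (if p (Fin.last m).castSucc then 1 else 0) + (if p (Fin.last (m+1)) then 1 else 0) := by
  simp only [Finset.card_filter]
  rw [Fin.sum_univ_castSucc, Fin.sum_univ_castSucc]

lemma aux_set {m : ℕ} (A B : Finset (Fin (m+2))) (h1 : (Fin.last m).castSucc ∉ A)
    (h2 : Fin.last (m+1) ∉ A) (h3 : (Fin.last m).castSucc ∉ B) (h4 : Fin.last (m+1) ∉ B) :
    A = B ↔ castdown2 A = castdown2 B := by
  constructor
  · rintro rfl; rfl
  · intro h
    ext j
    refine Fin.lastCases ?_ (fun j => ?_) j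
    · simp [h2, h4]
    · refine Fin.lastCases ?_ (fun j => ?_) j
      · simp [h1, h3]
      · have := congrArg (fun s => j ∈ s) h
        simpa [castdown2] using this

set_option maxHeartbeats 4000000 in
lemma aux_main (n : ℕ) (m : ℕ) (ga gb : Fin (m+2) → ℕ) (d w d' : ℕ) (a a' : ℕ → ℕ)
    (hd : 1 ≤ d) (hwd : w ≠ d) (hwn : w ≠ n) (hdn : d ≠ n) (had : a d = 1)
    (hinc : edgesAt ga gb d = {(Fin.last m).castSucc, Fin.last (m+1)})
    (S : Finset (Fin (m+2))) (hS : S ⊆ edgesAt ga gb n)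
    (h1 : (ga ((Fin.last m).castSucc) = d ∧ gb ((Fin.last m).castSucc) = w) ∨
       (ga ((Fin.last m).castSucc) = w ∧ gb ((Fin.last m).castSucc) = d))
    (h2 : (ga (Fin.last (m+1)) = d ∧ gb (Fin.last (m+1)) = w) ∨
       (ga (Fin.last (m+1)) = w ∧ gb (Fin.last (m+1)) = d))
    (hA : ∀ o : ℕ → ℕ, o d = 0 →
      ((∀ i, 1 ≤ i → i ≤ d → o i + (if i = d ∨ i = w then 1 else 0) = a i) ↔
       (∀ i, 1 ≤ i → i ≤ d' → o i = a' i))) :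
    MballW n ga gb d a S =
        2 * MballW n (fun j : Fin m => ga j.castSucc.castSucc)
          (fun j : Fin m => gb j.castSucc.castSucc) d' a' (castdown2 S) := by
  have hold : ∀ j : Fin m, ga j.castSucc.castSucc ≠ d ∧ gb j.castSucc.castSucc ≠ d := by
    intro j
    have : j.castSucc.castSucc ∉ edgesAt ga gb d := by
      rw [hinc]
      simp [Fin.ext_iff]
      omega
    simpa [edgesAt] using this
  have hE1 : (Fin.last m).castSucc ∉ edgesAt ga gb n := by
    simp only [edgesAt, Finset.mem_filter, Finset.mem_univ, true_and]; omega
  have hE2 : Fin.last (m+1) ∉ edgesAt ga gb n := by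
    simp only [edgesAt, Finset.mem_filter, Finset.mem_univ, true_and]; omega
  unfold MballW
  refine aux_card _ _ (decide (ga (Fin.last m).castSucc = d) ^^
    decide (ga (Fin.last (m+1)) = d) ^^ true) ?_
  intro O' x y
  set O : Fin (m+2) → Bool :=
    Fin.snoc (α := fun _ => Bool) (Fin.snoc (α := fun _ => Bool) O' x) y with hO
  have o1 : O (Fin.last m).castSucc = x := by simp [hO]
  have o2 : O (Fin.last (m+1)) = y := by simp [hO]
  have o3 : ∀ j : Fin m, O j.castSucc.castSucc = O' j := by intro j; simp [hO]
  have hsubo : outAt ga gb O n ⊆ edgesAt ga gb n := by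
    intro j; simp only [outAt, edgesAt, Finset.mem_filter, Finset.mem_univ, true_and]; tauto
  have hsubi : inAt ga gb O n ⊆ edgesAt ga gb n := by
    intro j; simp only [inAt, edgesAt, Finset.mem_filter, Finset.mem_univ, true_and]; tauto
  have hL : (∀ j, ga j = gb j → O j = false) ↔
      (∀ j : Fin m, ga j.castSucc.castSucc = gb j.castSucc.castSucc → O' j = false) := by
    constructor
    · intro h j hj; rw [← o3]; exact h _ hj
    · intro h j
      refine Fin.lastCases ?_ (fun j => ?_) j
      · intro h; omega
      · refine Fin.lastCases ?_ (fun j => ?_) j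
        · intro h; omega
        · rw [o3]; exact h j
  have hSo : outAt ga gb O n = S ↔ outAt (fun j : Fin m => ga j.castSucc.castSucc)
      (fun j : Fin m => gb j.castSucc.castSucc) O' n = castdown2 S := by
    rw [aux_set _ _ (fun h => hE1 (hsubo h)) (fun h => hE2 (hsubo h))
      (fun h => hE1 (hS h)) (fun h => hE2 (hS h))]
    have : castdown2 (outAt ga gb O n) = outAt (fun j : Fin m => ga j.castSucc.castSucc)
      (fun j : Fin m => gb j.castSucc.castSucc) O' n := by
      ext j; simp [castdown2, outAt, o3]
    rw [this]
  have hSi : inAt ga gb O n = edgesAt ga gb n \ S ↔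
      inAt (fun j : Fin m => ga j.castSucc.castSucc)
      (fun j : Fin m => gb j.castSucc.castSucc) O' n =
      edgesAt (fun j : Fin m => ga j.castSucc.castSucc)
      (fun j : Fin m => gb j.castSucc.castSucc) n \ castdown2 S := by
    rw [aux_set _ _ (fun h => hE1 (hsubi h)) (fun h => hE2 (hsubi h))
      (fun h => hE1 (Finset.sdiff_subset h)) (fun h => hE2 (Finset.sdiff_subset h))]
    have : castdown2 (inAt ga gb O n) = inAt (fun j : Fin m => ga j.castSucc.castSucc)
      (fun j : Fin m => gb j.castSucc.castSucc) O' n := by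
      ext j; simp [castdown2, inAt, o3]
    rw [this]
    have : castdown2 (edgesAt ga gb n \ S) = edgesAt (fun j : Fin m => ga j.castSucc.castSucc)
      (fun j : Fin m => gb j.castSucc.castSucc) n \ castdown2 S := by
      ext j; simp [castdown2, edgesAt]
    rw [this]
  rw [hL, hSo, hSi]
  set oo : ℕ → ℕ := fun i => (outAt (fun j : Fin m => ga j.castSucc.castSucc)
      (fun j : Fin m => gb j.castSucc.castSucc) O' i).card with hoo
  set ii : ℕ → ℕ := fun i => (inAt (fun j : Fin m => ga j.castSucc.castSucc)
      (fun j : Fin m => gb j.castSucc.castSucc) O' i).card with hii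
  have hood : oo d = 0 := by
    simp [hoo, outAt, hold]
  have hiid : ii d = 0 := by
    simp [hii, inAt, hold]
  have co : ∀ i, (outAt ga gb O i).card = oo i
      + (if (x = true ∧ ga (Fin.last m).castSucc = i) ∨ (x = false ∧ gb (Fin.last m).castSucc = i)
          then 1 else 0)
      + (if (y = true ∧ ga (Fin.last (m+1)) = i) ∨ (y = false ∧ gb (Fin.last (m+1)) = i)
          then 1 else 0) := by
    intro i
    simp only [hoo, outAt]
    rw [aux_filter]
    simp only [o1, o2, o3]
  have ci : ∀ i, (inAt ga gb O i).card = ii i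
      + (if (x = true ∧ gb (Fin.last m).castSucc = i) ∨ (x = false ∧ ga (Fin.last m).castSucc = i)
          then 1 else 0)
      + (if (y = true ∧ gb (Fin.last (m+1)) = i) ∨ (y = false ∧ ga (Fin.last (m+1)) = i)
          then 1 else 0) := by
    intro i
    simp only [hii, inAt]
    rw [aux_filter]
    simp only [o1, o2, o3]
  have key : (∀ i : ℕ, 1 ≤ i → i ≤ d →
        (outAt ga gb O i).card = a i ∧ (inAt ga gb O i).card = a i) ↔
      (y = (x ^^ (decide (ga (Fin.last m).castSucc = d) ^^
        decide (ga (Fin.last (m+1)) = d) ^^ true)) ∧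
       ∀ i : ℕ, 1 ≤ i → i ≤ d' → oo i = a' i ∧ ii i = a' i) := by
    have hY : (outAt ga gb O d).card = 1 → y = (x ^^ (decide (ga (Fin.last m).castSucc = d) ^^
        decide (ga (Fin.last (m+1)) = d) ^^ true)) := by
      rw [co, hood]
      rcases h1 with ⟨p, q⟩ | ⟨p, q⟩ <;> rcases h2 with ⟨r, s⟩ | ⟨r, s⟩ <;>
        cases x <;> cases y <;> simp [p, q, r, s, hwd]
    have hZ : y = (x ^^ (decide (ga (Fin.last m).castSucc = d) ^^
        decide (ga (Fin.last (m+1)) = d) ^^ true)) →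
        ∀ i, (outAt ga gb O i).card = oo i + (if i = d ∨ i = w then 1 else 0) ∧
          (inAt ga gb O i).card = ii i + (if i = d ∨ i = w then 1 else 0) := by
      intro hy i
      rw [co, ci, add_assoc, add_assoc]
      clear_value oo ii
      rcases h1 with ⟨p, q⟩ | ⟨p, q⟩ <;> rcases h2 with ⟨r, s⟩ | ⟨r, s⟩ <;>
        cases x <;> simp [p, q, r, s, hwd] at hy <;> subst hy <;>
        simp only [p, q, r, s] <;> simp <;> constructor <;> split_ifs <;> omega
    have e1 := hA oo hood
    have e2 := hA ii hiid
    constructor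
    · intro h
      have hy := hY (by rw [(h d hd le_rfl).1, had])
      have z := hZ hy
      refine ⟨hy, fun i hi hi' => ⟨e1.1 (fun i hi hi' => ?_) i hi hi',
        e2.1 (fun i hi hi' => ?_) i hi hi'⟩⟩
      · rw [← (z i).1, (h i hi hi').1]
      · rw [← (z i).2, (h i hi hi').2]
    · rintro ⟨hy, h⟩ i hi hi'
      rw [(hZ hy i).1, (hZ hy i).2]
      exact ⟨e1.2 (fun i hi hi' => (h i hi hi').1) i hi hi',
        e2.2 (fun i hi hi' => (h i hi hi').2) i hi hi'⟩
  rw [key]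
  exact ⟨fun ⟨p, ⟨q, r⟩, s, t⟩ => ⟨q, p, r, s, t⟩, fun ⟨q, p, r, s, t⟩ => ⟨p, ⟨q, r⟩, s, t⟩⟩

/-- (Lemma 4.5, type 2 and type 3 recurrences) Suppose `a_d = 1` and `v_d` is
incident to exactly the two edges `e_{m−1}` and `e_m` (the last two edges,
indices `(Fin.last m).castSucc` and `Fin.last (m+1)` of `Fin (m+2)`).
(Type 2) If `2 ≤ d ≤ n−1`, `a_{d−1} ≥ 1`, and both edges join `v_d` and
`v_{d−1}`, then `M_{G,a}(S) = 2 · M_{G−e_{m−1}−e_m,a'}(S)` with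
`a' = (a_1,…,a_{d−2},a_{d−1}−1)`.
(Type 3) If `1 ≤ d < n−1` and both edges join `v_d` and `v_{d+1}`, then
`M_{G,a}(S) = 2 · M_{G−e_{m−1}−e_m,a''}(S)` with `a'' = (a_1,…,a_{d−1})`. -/
theorem lem_4_5 (n : ℕ) (m : ℕ) (ga gb : Fin (m+2) → ℕ)
    (hga : ∀ j, 1 ≤ ga j ∧ ga j ≤ n) (hgb : ∀ j, 1 ≤ gb j ∧ gb j ≤ n)
    (d : ℕ) (a : ℕ → ℕ) (had : a d = 1)
    (hinc : edgesAt ga gb d = {(Fin.last m).castSucc, Fin.last (m+1)})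
    (S : Finset (Fin (m+2))) (hS : S ⊆ edgesAt ga gb n) :
    (2 ≤ d → d ≤ n - 1 → 1 ≤ a (d - 1) →
      ((ga ((Fin.last m).castSucc) = d ∧ gb ((Fin.last m).castSucc) = d - 1) ∨
       (ga ((Fin.last m).castSucc) = d - 1 ∧ gb ((Fin.last m).castSucc) = d)) →
      ((ga (Fin.last (m+1)) = d ∧ gb (Fin.last (m+1)) = d - 1) ∨
       (ga (Fin.last (m+1)) = d - 1 ∧ gb (Fin.last (m+1)) = d)) →
      MballW n ga gb d a S =
        2 * MballW n (fun j : Fin m => ga j.castSucc.castSucc)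
          (fun j : Fin m => gb j.castSucc.castSucc)
          (d - 1) (fun i => if i = d - 1 then a (d - 1) - 1 else a i) (castdown2 S)) ∧
    (1 ≤ d → d < n - 1 →
      ((ga ((Fin.last m).castSucc) = d ∧ gb ((Fin.last m).castSucc) = d + 1) ∨
       (ga ((Fin.last m).castSucc) = d + 1 ∧ gb ((Fin.last m).castSucc) = d)) →
      ((ga (Fin.last (m+1)) = d ∧ gb (Fin.last (m+1)) = d + 1) ∨
       (ga (Fin.last (m+1)) = d + 1 ∧ gb (Fin.last (m+1)) = d)) →
      MballW n ga gb d a S =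
        2 * MballW n (fun j : Fin m => ga j.castSucc.castSucc)
          (fun j : Fin m => gb j.castSucc.castSucc)
          (d - 1) a (castdown2 S)) := by
  constructor
  · intro hd hdn ha h1 h2
    refine aux_main n m ga gb d (d - 1) (d - 1) a _ (by omega) (by omega) (by omega) (by omega)
      had hinc S hS h1 h2 ?_
    intro o ho
    constructor
    · intro h i hi hi'
      have := h i hi (by omega)
      by_cases e : i = d - 1
      · subst e
        simp at this ⊢
        omega
      · have e' : i ≠ d := by omega
        simpa [e, e'] using this
    · intro h i hi hi'
      by_cases e' : i = d
      · subst e'; simp [ho, had]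
      · have := h i hi (by omega)
        by_cases e : i = d - 1
        · subst e
          simp at this ⊢
          omega
        · simpa [e, e'] using this
  · intro hd hdn h1 h2
    refine aux_main n m ga gb d (d + 1) (d - 1) a _ (by omega) (by omega) (by omega) (by omega)
      had hinc S hS h1 h2 ?_
    intro o ho
    constructor
    · intro h i hi hi'
      have := h i hi (by omega)
      have e : i ≠ d + 1 := by omega
      have e' : i ≠ d := by omega
      simpa [e, e'] using this
    · intro h i hi hi'
      by_cases e' : i = d
      · subst e'; simp [ho, had]
      · have := h i hi (by omega)
        have e : i ≠ d + 1 := by omega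
        simpa [e, e'] using this
end

section
/- (Lemma 4.6, type 4 recurrence) Let 1 ≤ d ≤ n−1 and a = (a_1,…,a_d) ∈ ℕ^d with a_d = 1, and suppose v_d is incident to exactly two edges, namely e_{m−1} and e_m, both of which join v_d and v_n (so m−1, m ∈ X). Then for every S ⊆ X: if |S ∩ {m−1, m}| = 1, then M_{G,a}(S) = M_{G−e_{m−1}−e_m, a'}(S ∖ {m−1, m}), where a' = (a_1,…,a_{d−1}) ∈ ℕ^{d−1} and the set of edge indices at v_n in G − e_{m−1} − e_m is X ∖ {m−1, m}; otherwise M_{G,a}(S) = 0. -/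
open Finset
open scoped Classical

theorem aux_out_card {m : ℕ} (ga gb : Fin (m+2) → ℕ) (O : Fin (m+2) → Bool) (v : ℕ) :
    (outAt ga gb O v).card =
      (outAt (fun j : Fin m => ga j.castSucc.castSucc) (fun j : Fin m => gb j.castSucc.castSucc)
        (fun j : Fin m => O j.castSucc.castSucc) v).card
      + (if (O (Fin.last m).castSucc = true ∧ ga (Fin.last m).castSucc = v) ∨
          (O (Fin.last m).castSucc = false ∧ gb (Fin.last m).castSucc = v) then 1 else 0)
      + (if (O (Fin.last (m+1)) = true ∧ ga (Fin.last (m+1)) = v) ∨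
          (O (Fin.last (m+1)) = false ∧ gb (Fin.last (m+1)) = v) then 1 else 0) := by
  unfold outAt
  rw [Finset.card_filter, Finset.card_filter, Fin.sum_univ_castSucc, Fin.sum_univ_castSucc]

theorem aux_in_out {m : ℕ} (ga gb : Fin m → ℕ) (O : Fin m → Bool) (v : ℕ) :
    inAt ga gb O v = outAt gb ga O v := rfl

theorem aux_main_s17 (n : ℕ) (m : ℕ) (ga gb : Fin (m+2) → ℕ)
    (d : ℕ) (hd1 : 1 ≤ d) (hdn : d < n) (a : ℕ → ℕ) (had : a d = 1)
    (hinc : ∀ j : Fin m, ga j.castSucc.castSucc ≠ d ∧ gb j.castSucc.castSucc ≠ d)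
    (h1 : (ga ((Fin.last m).castSucc) = d ∧ gb ((Fin.last m).castSucc) = n) ∨
          (ga ((Fin.last m).castSucc) = n ∧ gb ((Fin.last m).castSucc) = d))
    (h2 : (ga (Fin.last (m+1)) = d ∧ gb (Fin.last (m+1)) = n) ∨
          (ga (Fin.last (m+1)) = n ∧ gb (Fin.last (m+1)) = d))
    (S : Finset (Fin (m+2))) (O : Fin (m+2) → Bool) :
    ((∀ j, ga j = gb j → O j = false) ∧
    (∀ i : ℕ, 1 ≤ i → i ≤ d → (outAt ga gb O i).card = a i ∧ (inAt ga gb O i).card = a i) ∧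
    outAt ga gb O n = S ∧ inAt ga gb O n = edgesAt ga gb n \ S) ↔
    (((∀ j : Fin m, ga j.castSucc.castSucc = gb j.castSucc.castSucc →
        O j.castSucc.castSucc = false) ∧
    (∀ i : ℕ, 1 ≤ i → i ≤ d - 1 →
      (outAt (fun j : Fin m => ga j.castSucc.castSucc) (fun j : Fin m => gb j.castSucc.castSucc)
        (fun j : Fin m => O j.castSucc.castSucc) i).card = a i ∧
      (inAt (fun j : Fin m => ga j.castSucc.castSucc) (fun j : Fin m => gb j.castSucc.castSucc)
        (fun j : Fin m => O j.castSucc.castSucc) i).card = a i) ∧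
    outAt (fun j : Fin m => ga j.castSucc.castSucc) (fun j : Fin m => gb j.castSucc.castSucc)
        (fun j : Fin m => O j.castSucc.castSucc) n
      = castdown2 (S \ {(Fin.last m).castSucc, Fin.last (m+1)}) ∧
    inAt (fun j : Fin m => ga j.castSucc.castSucc) (fun j : Fin m => gb j.castSucc.castSucc)
        (fun j : Fin m => O j.castSucc.castSucc) n
      = edgesAt (fun j : Fin m => ga j.castSucc.castSucc)
          (fun j : Fin m => gb j.castSucc.castSucc) n
        \ castdown2 (S \ {(Fin.last m).castSucc, Fin.last (m+1)})) ∧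
    O (Fin.last m).castSucc = decide ((Fin.last m).castSucc ∈ S ↔ ga (Fin.last m).castSucc = n) ∧
    O (Fin.last (m+1)) = decide (Fin.last (m+1) ∈ S ↔ ga (Fin.last (m+1)) = n)) ∧
    ¬ ((Fin.last m).castSucc ∈ S ↔ Fin.last (m+1) ∈ S) := by
  have z1 : (outAt (fun j : Fin m => ga j.castSucc.castSucc)
      (fun j : Fin m => gb j.castSucc.castSucc)
      (fun j : Fin m => O j.castSucc.castSucc) d).card = 0 := by
    simp [outAt, hinc]
  have z2 : (outAt (fun j : Fin m => gb j.castSucc.castSucc)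
      (fun j : Fin m => ga j.castSucc.castSucc)
      (fun j : Fin m => O j.castSucc.castSucc) d).card = 0 := by
    simp [outAt, hinc]
  have hne : d ≠ n := hdn.ne
  have hne' : n ≠ d := hdn.ne'
  have key : (∀ i : ℕ, 1 ≤ i → i ≤ d →
        (outAt ga gb O i).card = a i ∧ (inAt ga gb O i).card = a i) ↔
      (∀ i : ℕ, 1 ≤ i → i ≤ d - 1 →
      (outAt (fun j : Fin m => ga j.castSucc.castSucc) (fun j : Fin m => gb j.castSucc.castSucc)
        (fun j : Fin m => O j.castSucc.castSucc) i).card = a i ∧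
      (inAt (fun j : Fin m => ga j.castSucc.castSucc) (fun j : Fin m => gb j.castSucc.castSucc)
        (fun j : Fin m => O j.castSucc.castSucc) i).card = a i) ∧
      ((outAt ga gb O d).card = 1 ∧ (inAt ga gb O d).card = 1) := by
    have st : ∀ i, i ≤ d - 1 → 1 ≤ i → (outAt ga gb O i).card =
        (outAt (fun j : Fin m => ga j.castSucc.castSucc) (fun j : Fin m => gb j.castSucc.castSucc)
        (fun j : Fin m => O j.castSucc.castSucc) i).card ∧ (inAt ga gb O i).card =
        (inAt (fun j : Fin m => ga j.castSucc.castSucc) (fun j : Fin m => gb j.castSucc.castSucc)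
        (fun j : Fin m => O j.castSucc.castSucc) i).card := by
      intro i hi hi1
      have e1 : d ≠ i := by omega
      have e2 : n ≠ i := by omega
      rw [aux_in_out, aux_in_out, aux_out_card, aux_out_card gb ga]
      rcases h1 with ⟨h, h'⟩ | ⟨h, h'⟩ <;> rcases h2 with ⟨k, k'⟩ | ⟨k, k'⟩ <;>
        simp [h, h', k, k', e1, e2]
    constructor
    · intro h
      refine ⟨fun i hi hi' => ?_, ?_⟩
      · rw [← (st i hi' hi).1, ← (st i hi' hi).2]
        exact h i hi (by omega)
      · rw [← had]; exact h d hd1 le_rfl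
    · rintro ⟨h, h'⟩ i hi hid
      by_cases e : i = d
      · subst e; rw [had]; exact h'
      · rw [(st i (by omega) hi).1, (st i (by omega) hi).2]
        exact h i hi (by omega)
  rw [key, aux_in_out ga gb O d, aux_out_card, aux_out_card gb ga, z1, z2]
  have hpq : (Fin.last m).castSucc ≠ Fin.last (m+1) := (Fin.castSucc_lt_last _).ne
  have c1 : ∀ j : Fin m, j.castSucc.castSucc ≠ (Fin.last m).castSucc := fun j h =>
    (Fin.castSucc_lt_last j).ne (Fin.castSucc_injective _ h)
  have c2 : ∀ j : Fin m, j.castSucc.castSucc ≠ Fin.last (m+1) := fun j =>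
    (Fin.castSucc_lt_last _).ne
  simp only [Finset.ext_iff, Fin.forall_fin_succ', outAt, inAt, edgesAt, castdown2,
    Finset.mem_filter, Finset.mem_univ, true_and, Finset.mem_sdiff, Finset.mem_preimage,
    Finset.mem_insert, Finset.mem_singleton, c1, c2, or_self, not_false_eq_true, and_true]
  generalize (∀ i : ℕ, 1 ≤ i → i ≤ d - 1 → _) = A
  by_cases hp : (Fin.last m).castSucc ∈ S <;> by_cases hq : Fin.last (m+1) ∈ S <;>
  cases ho : O (Fin.last m).castSucc <;> cases hr : O (Fin.last (m+1)) <;>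
  rcases h1 with ⟨h, h'⟩ | ⟨h, h'⟩ <;> rcases h2 with ⟨k, k'⟩ | ⟨k, k'⟩ <;>
    simp [h, h', k, k', hne, hne', hp, hq]

/-- (Lemma 4.6, type 4 recurrence) Suppose `1 ≤ d ≤ n−1`, `a_d = 1`, and `v_d`
is incident to exactly the two edges `e_{m−1}` and `e_m` (the last two edges,
indices `(Fin.last m).castSucc` and `Fin.last (m+1)` of `Fin (m+2)`), both of
which join `v_d` and `v_n`.  If `|S ∩ {e_{m−1}, e_m}| = 1`, then
`M_{G,a}(S) = M_{G−e_{m−1}−e_m,a'}(S ∖ {e_{m−1}, e_m})` with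
`a' = (a_1,…,a_{d−1})`; otherwise `M_{G,a}(S) = 0`. -/
theorem lem_4_6 (n : ℕ) (m : ℕ) (ga gb : Fin (m+2) → ℕ)
    (hga : ∀ j, 1 ≤ ga j ∧ ga j ≤ n) (hgb : ∀ j, 1 ≤ gb j ∧ gb j ≤ n)
    (d : ℕ) (hd1 : 1 ≤ d) (hd2 : d ≤ n - 1) (a : ℕ → ℕ) (had : a d = 1)
    (hinc : edgesAt ga gb d = {(Fin.last m).castSucc, Fin.last (m+1)})
    (h1 : (ga ((Fin.last m).castSucc) = d ∧ gb ((Fin.last m).castSucc) = n) ∨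
          (ga ((Fin.last m).castSucc) = n ∧ gb ((Fin.last m).castSucc) = d))
    (h2 : (ga (Fin.last (m+1)) = d ∧ gb (Fin.last (m+1)) = n) ∨
          (ga (Fin.last (m+1)) = n ∧ gb (Fin.last (m+1)) = d))
    (S : Finset (Fin (m+2))) (hS : S ⊆ edgesAt ga gb n) :
    ((S ∩ {(Fin.last m).castSucc, Fin.last (m+1)}).card = 1 →
      MballW n ga gb d a S =
        MballW n (fun j : Fin m => ga j.castSucc.castSucc)
          (fun j : Fin m => gb j.castSucc.castSucc)
          (d - 1) a (castdown2 (S \ {(Fin.last m).castSucc, Fin.last (m+1)}))) ∧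
    ((S ∩ {(Fin.last m).castSucc, Fin.last (m+1)}).card ≠ 1 →
      MballW n ga gb d a S = 0) := by
  have hdn : d < n := by omega
  have hinc' : ∀ j : Fin m, ga j.castSucc.castSucc ≠ d ∧ gb j.castSucc.castSucc ≠ d := by
    intro j
    have c1 : j.castSucc.castSucc ≠ (Fin.last m).castSucc := fun h =>
      (Fin.castSucc_lt_last j).ne (Fin.castSucc_injective _ h)
    have c2 : j.castSucc.castSucc ≠ Fin.last (m+1) := (Fin.castSucc_lt_last _).ne
    have : j.castSucc.castSucc ∉ edgesAt ga gb d := by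
      rw [hinc]; simp [c1, c2]
    simpa [edgesAt] using this
  have hpq : (Fin.last m).castSucc ≠ Fin.last (m+1) := (Fin.castSucc_lt_last _).ne
  have hcard : (S ∩ {(Fin.last m).castSucc, Fin.last (m+1)}).card = 1 ↔
      ¬ ((Fin.last m).castSucc ∈ S ↔ Fin.last (m+1) ∈ S) := by
    rw [Finset.inter_comm]
    by_cases hp : (Fin.last m).castSucc ∈ S <;> by_cases hq : Fin.last (m+1) ∈ S <;>
      simp [Finset.insert_inter_of_mem, Finset.insert_inter_of_notMem, hp, hq, hpq]
  rw [hcard]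
  constructor
  · intro hc
    unfold MballW
    refine Finset.card_nbij' (fun O j => O j.castSucc.castSucc)
      (fun O' => Fin.snoc (α := fun _ => Bool) (Fin.snoc (α := fun _ => Bool) O'
        (decide ((Fin.last m).castSucc ∈ S ↔ ga (Fin.last m).castSucc = n)))
        (decide (Fin.last (m+1) ∈ S ↔ ga (Fin.last (m+1)) = n))) ?_ ?_ ?_ ?_
    · intro O hO
      simp only [Finset.coe_filter, Finset.mem_univ, true_and, Set.mem_ofPred_eq] at hO ⊢
      exact ((aux_main_s17 n m ga gb d hd1 hdn a had hinc' h1 h2 S O).1 hO).1.1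
    · intro O' hO
      simp only [Finset.coe_filter, Finset.mem_univ, true_and, Set.mem_ofPred_eq] at hO ⊢
      rw [aux_main_s17 n m ga gb d hd1 hdn a had hinc' h1 h2 S]
      simp only [Fin.snoc_castSucc, Fin.snoc_last]
      exact ⟨⟨hO, trivial, trivial⟩, hc⟩
    · intro O hO
      simp only [Finset.coe_filter, Finset.mem_univ, true_and, Set.mem_ofPred_eq] at hO
      obtain ⟨⟨-, e1, e2⟩, -⟩ := (aux_main_s17 n m ga gb d hd1 hdn a had hinc' h1 h2 S O).1 hO
      funext j
      refine Fin.lastCases ?_ (fun j => ?_) j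
      · simp only [Fin.snoc_last, e2]
      · refine Fin.lastCases ?_ (fun j => ?_) j
        · simp only [Fin.snoc_castSucc, Fin.snoc_last, e1]
        · simp only [Fin.snoc_castSucc]
    · intro O' hO
      funext j
      simp only [Fin.snoc_castSucc]
  · intro hc
    unfold MballW
    rw [Finset.card_eq_zero, Finset.filter_eq_empty_iff]
    intro O _ hO
    exact hc (hcard.2 ((aux_main_s17 n m ga gb d hd1 hdn a had hinc' h1 h2 S O).1 hO).2)
end
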